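/- arXiv:1702.03787 — 3 statements merged into one kernel-verified Lean document; each statement's English description precedes it below -/
import Mathlib

section
/- Let T be a simple graph on vertex set ℕ and let θ : G_T → G_T be any function. Then θ is a group automorphism of G_T if and only if the following two conditions hold: (i) θ(w w') = θ(w) θ(w') for all w, w' ∈ G_T; (ii) there exist ρ ∈ Aut(T), t ∈ G_T, and ε ∈ {−1, 1} such that θ(v_i) = t v_{ρ(i)}^ε t^{−1} for all i ∈ ℕ. -/
/-- The relators of Williams' group `G_T` associated to a graph with adjacency relation
`Adj`: the relators are `v_i^7`, `(v_i v_j)^11` for adjacent `i, j`, and `(v_i v_j)^13`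
for distinct non-adjacent `i, j`. -/
def grRels (Adj : ℕ → ℕ → Prop) : Set (FreeGroup ℕ) :=
  {r | (∃ i, r = FreeGroup.of i ^ 7) ∨
    (∃ i j, Adj i j ∧ r = (FreeGroup.of i * FreeGroup.of j) ^ 11) ∨
    (∃ i j, i ≠ j ∧ ¬ Adj i j ∧ r = (FreeGroup.of i * FreeGroup.of j) ^ 13)}

/-- Williams' group `G_T`, presented by the generators `v_i` and the relators above. -/
abbrev GT (Adj : ℕ → ℕ → Prop) : Type := PresentedGroup (grRels Adj)

/-- The generator `v_i` of `G_T`. -/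
def gen (Adj : ℕ → ℕ → Prop) (i : ℕ) : GT Adj := PresentedGroup.of i


namespace Wm

open FreeGroup

/-- `z` lies beyond the positive edge `g → g * of i` of the Cayley tree. -/
def Hs (g : FreeGroup ℕ) (i : ℕ) (z : FreeGroup ℕ) : Prop :=
  (g⁻¹ * z).toWord.head? = some (i, true)

theorem Hs_smul (h g : FreeGroup ℕ) (i : ℕ) (z : FreeGroup ℕ) :
    Hs (h * g) i (h * z) ↔ Hs g i z := by
  unfold Hs
  rw [show (h * g)⁻¹ * (h * z) = g⁻¹ * z by group]

theorem not_Hs_self (g : FreeGroup ℕ) (i : ℕ) : ¬ Hs g i g := by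
  simp [Hs]

theorem Hs_next (g : FreeGroup ℕ) (i : ℕ) : Hs g i (g * of i) := by
  simp [Hs]

theorem toWord_of_reduced {L : List (ℕ × Bool)} (h : IsReduced L) : (mk L).toWord = L := by
  rw [toWord_mk, h.reduce_eq]

theorem isReduced_append {L M : List (ℕ × Bool)} (hL : IsReduced L) (hM : IsReduced M)
    (h : ∀ a ∈ L.getLast?, ∀ b ∈ M.head?, a.1 = b.1 → a.2 = b.2) : IsReduced (L ++ M) := by
  unfold FreeGroup.IsReduced at *
  rw [List.isChain_append]
  exact ⟨hL, hM, h⟩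

theorem toWord_mul_of (y : FreeGroup ℕ) (j : ℕ) :
    (∃ L, y.toWord = L ++ [(j, false)] ∧ (y * of j).toWord = L) ∨
    (y * of j).toWord = y.toWord ++ [(j, true)] := by
  have key : y * of j = mk (y.toWord ++ [(j, true)]) := by
    rw [← mul_mk, mk_toWord]; rfl
  by_cases h : y.toWord.getLast? = some (j, false)
  · left
    obtain ⟨L, hL⟩ := List.getLast?_eq_some_iff.1 h
    refine ⟨L, hL, ?_⟩
    have hr : IsReduced L := (isReduced_toWord (x := y)).infix ⟨[], [(j, false)], by simp [hL]⟩
    have : y * of j = mk L := by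
      rw [← mk_toWord (x := y), hL, ← mul_mk]
      change mk L * (of j)⁻¹ * of j = mk L
      group
    rw [this, toWord_of_reduced hr]
  · right
    rw [key]
    apply toWord_of_reduced
    apply isReduced_append isReduced_toWord IsReduced.singleton
    rintro ⟨a, b⟩ ha c hc hab
    simp at hc
    subst hc
    simp at hab
    subst hab
    cases b
    · exact absurd ha h
    · rfl

theorem Hs_step (g x : FreeGroup ℕ) (i j : ℕ) :
    Hs g i (x * of j) ↔ (Hs g i x ∨ (x = g ∧ i = j)) := by
  unfold Hs
  rw [← mul_assoc]
  have hx : x = g ↔ (g⁻¹ * x) = 1 := by rw [inv_mul_eq_one, eq_comm]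
  rw [hx]
  generalize g⁻¹ * x = y
  rw [← toWord_eq_nil_iff (x := y)]
  rcases toWord_mul_of y j with ⟨L, h1, h2⟩ | h
  · rw [h1, h2]
    cases L <;> simp
  · rw [h]
    cases hy : y.toWord with
    | nil => simp [eq_comm]
    | cons a l => simp

theorem Hs_compl (g : FreeGroup ℕ) (i : ℕ) (z : FreeGroup ℕ) :
    Hs g i z ↔ ¬ ((g * of i)⁻¹ * z).toWord.head? = some (i, false) := by
  unfold Hs
  have : g⁻¹ * z = of i * ((g * of i)⁻¹ * z) := by group
  rw [this]
  generalize (g * of i)⁻¹ * z = y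
  have key : of i * y = mk ((i, true) :: y.toWord) := by
    conv_lhs => rw [← mk_toWord (x := y)]
    rfl
  rw [key, toWord_mk, reduce.cons, reduce_toWord]
  have hy := isReduced_toWord (x := y)
  cases h : y.toWord with
  | nil => simp
  | cons a l =>
    rw [h] at hy
    rcases a with ⟨a, b⟩
    simp only [List.head?_cons, Option.some.injEq, Prod.mk.injEq]
    by_cases hc : i = a ∧ true = !b
    · simp only [hc, and_self, if_true]
      obtain ⟨rfl, hb⟩ := hc
      have hb : b = false := by simpa using hb.symm
      subst hb
      cases l with
      | nil => simp
      | cons c l =>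
        rcases c with ⟨c, d⟩
        have := (FreeGroup.isReduced_cons_cons.1 hy).1
        simp at this
        simp
        intro e1
        exact this e1.symm
    · simp only [hc, if_false]
      simp
      intro h1
      by_contra h2
      apply hc
      simp at h2
      simp [h1, h2]

theorem Hs_chain (g : FreeGroup ℕ) (i j : ℕ) (z : FreeGroup ℕ) (h : Hs (g * of i) j z) :
    Hs g i z := by
  rw [Hs_compl]
  unfold Hs at h
  rw [h]
  simp

/-- Every edge separating `x` and `y` satisfies `E`. -/
def Rel (E : FreeGroup ℕ → ℕ → Prop) (x y : FreeGroup ℕ) : Prop :=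
  ∀ g i, ¬ (Hs g i x ↔ Hs g i y) → E g i

theorem Rel.refl {E} (x) : Rel E x x := fun _ _ h => absurd Iff.rfl h
theorem Rel.symm {E x y} (h : Rel E x y) : Rel E y x := fun g i h' => h g i (fun e => h' e.symm)
theorem Rel.trans {E x y z} (h : Rel E x y) (h2 : Rel E y z) : Rel E x z := by
  intro g i h'
  by_cases hc : Hs g i x ↔ Hs g i y
  · exact h2 g i (fun e => h' (hc.trans e))
  · exact h g i hc
theorem Rel.mono {E E' : FreeGroup ℕ → ℕ → Prop} {x y} (h : Rel E x y)
    (hE : ∀ g i, E g i → E' g i) : Rel E' x y := fun g i h' => hE g i (h g i h')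
theorem Rel.step {E : FreeGroup ℕ → ℕ → Prop} {x : FreeGroup ℕ} {j : ℕ} (h : E x j) :
    Rel E x (x * of j) := by
  intro g i hne
  rw [Hs_step] at hne
  by_cases hc : x = g ∧ i = j
  · obtain ⟨rfl, rfl⟩ := hc; exact h
  · simp [hc] at hne
theorem Rel.smul {E : FreeGroup ℕ → ℕ → Prop} {x y : FreeGroup ℕ} (u : FreeGroup ℕ)
    (h : Rel E x y) (hE : ∀ g i, E g i → E (u * g) i) : Rel E (u * x) (u * y) := by
  intro g i hne
  have : g = u * (u⁻¹ * g) := by group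
  rw [this] at hne ⊢
  rw [Hs_smul, Hs_smul] at hne
  exact hE _ _ (h _ _ hne)

/-- Connected vertex sets of the tree. -/
def Conn (A : Set (FreeGroup ℕ)) : Prop :=
  ∀ x ∈ A, ∀ y ∈ A, Rel (fun g i => g ∈ A ∧ g * of i ∈ A) x y

theorem Rel.step_any {A : Set (FreeGroup ℕ)} {x : FreeGroup ℕ} (s : ℕ × Bool) (hx : x ∈ A)
    (hy : x * mk [s] ∈ A) : Rel (fun g i => g ∈ A ∧ g * of i ∈ A) x (x * mk [s]) := by
  rcases s with ⟨j, b⟩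
  cases b
  · have e : x = x * mk [(j, false)] * of j := by
      change x = x * (of j)⁻¹ * of j
      group
    have := Rel.step (E := fun g i => g ∈ A ∧ g * of i ∈ A) (x := x * mk [(j, false)]) (j := j)
      ⟨hy, by rw [← e]; exact hx⟩
    rw [← e] at this
    exact this.symm
  · exact Rel.step (E := fun g i => g ∈ A ∧ g * of i ∈ A) ⟨hx, hy⟩

theorem Hs_mk (g : FreeGroup ℕ) (i : ℕ) {L : List (ℕ × Bool)} (h : IsReduced L) :
    Hs g i (g * mk L) ↔ L.head? = some (i, true) := by
  unfold Hs
  rw [inv_mul_cancel_left, toWord_of_reduced h]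

theorem conn_Hs (g : FreeGroup ℕ) (i : ℕ) : Conn {z | Hs g i z} := by
  have key : ∀ L : List (ℕ × Bool), IsReduced L → L.head? = some (i, true) →
      Rel (fun x j => x ∈ {z | Hs g i z} ∧ x * of j ∈ {z | Hs g i z}) (g * of i) (g * mk L) := by
    intro L
    induction L using List.reverseRecOn with
    | nil => intro _ h; simp at h
    | append_singleton L s ih =>
      intro hr hh
      have hrL : IsReduced L := hr.infix ⟨[], [s], by simp⟩
      cases L with
      | nil =>
        simp at hh
        subst hh
        exact Rel.refl _
      | cons a l =>
        have hhL : (a :: l).head? = some (i, true) := by simpa using hh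
        refine (ih hrL hhL).trans ?_
        have e : g * mk (a :: l ++ [s]) = g * mk (a :: l) * mk [s] := by
          rw [← mul_mk, mul_assoc]
        rw [e]
        apply Rel.step_any
        · exact (Hs_mk g i hrL).2 hhL
        · rw [← e]; exact (Hs_mk g i hr).2 hh
  have key2 : ∀ z, Hs g i z →
      Rel (fun x j => x ∈ {z | Hs g i z} ∧ x * of j ∈ {z | Hs g i z}) (g * of i) z := by
    intro z hz
    have := key (g⁻¹ * z).toWord isReduced_toWord hz
    rwa [mk_toWord, mul_inv_cancel_left] at this
  intro x hx y hy
  exact (key2 x hx).symm.trans (key2 y hy)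

theorem conn_not_Hs (g : FreeGroup ℕ) (i : ℕ) : Conn {z | ¬ Hs g i z} := by
  have key : ∀ L : List (ℕ × Bool), IsReduced L → ¬ L.head? = some (i, true) →
      Rel (fun x j => x ∈ {z | ¬ Hs g i z} ∧ x * of j ∈ {z | ¬ Hs g i z}) g (g * mk L) := by
    intro L
    induction L using List.reverseRecOn with
    | nil => intro _ h; rw [← one_eq_mk, mul_one]; exact Rel.refl _
    | append_singleton L s ih =>
      intro hr hh
      have hrL : IsReduced L := hr.infix ⟨[], [s], by simp⟩
      have hhL : ¬ L.head? = some (i, true) := by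
        intro h
        apply hh
        cases L with
        | nil => simp at h
        | cons a l => simpa using h
      refine (ih hrL hhL).trans ?_
      have e : g * mk (L ++ [s]) = g * mk L * mk [s] := by
        rw [← mul_mk, mul_assoc]
      rw [e]
      apply Rel.step_any
      · exact fun h => hhL ((Hs_mk g i hrL).1 h)
      · rw [← e]; exact fun h => hh ((Hs_mk g i hr).1 h)
  have key2 : ∀ z, ¬ Hs g i z →
      Rel (fun x j => x ∈ {z | ¬ Hs g i z} ∧ x * of j ∈ {z | ¬ Hs g i z}) g z := by
    intro z hz
    have := key (g⁻¹ * z).toWord isReduced_toWord hz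
    rwa [mk_toWord, mul_inv_cancel_left] at this
  intro x hx y hy
  exact (key2 x hx).symm.trans (key2 y hy)

/-- signed half-spaces -/
def SH (g : FreeGroup ℕ) (i : ℕ) (b : Bool) : Set (FreeGroup ℕ) :=
  if b then {z | Hs g i z} else {z | ¬ Hs g i z}

theorem conn_SH (g i b) : Conn (SH g i b) := by
  cases b
  · simpa [SH] using conn_not_Hs g i
  · simpa [SH] using conn_Hs g i

theorem SH_disj {g i b g' i' b'} (h1 : g ∉ SH g' i' b') (h2 : g * of i ∉ SH g' i' b')
    (h3 : g' ∉ SH g i b) (h4 : g' * of i' ∉ SH g i b) (z : FreeGroup ℕ) (hz : z ∈ SH g i b) :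
    z ∉ SH g' i' b' := by
  intro hz'
  have hc := conn_SH g i b
  have : ∃ x ∈ SH g i b, x ∉ SH g' i' b' := by
    cases b
    · exact ⟨g, by simp [SH, not_Hs_self], h1⟩
    · exact ⟨g * of i, by simp [SH, Hs_next], h2⟩
  obtain ⟨x, hx, hx'⟩ := this
  have := hc x hx z hz g' i' (by
    cases b'
    · simp [SH] at hx' hz'
      simp [hx', hz']
    · simp [SH] at hx' hz'
      simp [hx', hz'])
  exact h3 this.1

end Wm


namespace Wm

open FreeGroup

/-- Periodic positive lines of period two in the Cayley tree. -/
@[ext] structure Line where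
  c : ℤ → FreeGroup ℕ
  a : ℤ → ℕ
  hc : ∀ n, c (n + 1) = c n * of (a n)
  ha : ∀ n, a (n + 2) = a n

namespace Line

def shift (ℓ : Line) (k : ℤ) : Line where
  c n := ℓ.c (n + k)
  a n := ℓ.a (n + k)
  hc n := by rw [show n + 1 + k = n + k + 1 by ring, ℓ.hc]
  ha n := by rw [show n + 2 + k = n + k + 2 by ring, ℓ.ha]

def tr (h : FreeGroup ℕ) (ℓ : Line) : Line where
  c n := h * ℓ.c n
  a n := ℓ.a n
  hc n := by rw [ℓ.hc, mul_assoc]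
  ha n := ℓ.ha n

@[simp] theorem shift_c (ℓ : Line) (k n : ℤ) : (ℓ.shift k).c n = ℓ.c (n + k) := rfl
@[simp] theorem shift_a (ℓ : Line) (k n : ℤ) : (ℓ.shift k).a n = ℓ.a (n + k) := rfl
@[simp] theorem tr_c (ℓ : Line) (h) (n : ℤ) : (ℓ.tr h).c n = h * ℓ.c n := rfl
@[simp] theorem tr_a (ℓ : Line) (h) (n : ℤ) : (ℓ.tr h).a n = ℓ.a n := rfl
theorem tr_tr (ℓ : Line) (h k) : (ℓ.tr h).tr k = ℓ.tr (k * h) := by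
  ext n <;> simp [mul_assoc]
theorem tr_one (ℓ : Line) : ℓ.tr 1 = ℓ := by
  ext n <;> simp
theorem tr_shift (ℓ : Line) (h k) : (ℓ.shift k).tr h = (ℓ.tr h).shift k := rfl
theorem shift_shift (ℓ : Line) (h k) : (ℓ.shift k).shift h = ℓ.shift (h + k) := by
  ext n <;> simp [add_assoc]
theorem shift_zero (ℓ : Line) : ℓ.shift 0 = ℓ := by
  ext n <;> simp

/-- position on the line -/
def P (ℓ : Line) (n : ℤ) (z : FreeGroup ℕ) : Prop := Hs (ℓ.c n) (ℓ.a n) z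

theorem P_tr (ℓ : Line) (h n z) : (ℓ.tr h).P n (h * z) ↔ ℓ.P n z := Hs_smul _ _ _ _
theorem P_shift (ℓ : Line) (k n z) : (ℓ.shift k).P n z ↔ ℓ.P (n + k) z := Iff.rfl

theorem P_anti (ℓ : Line) {m n : ℤ} (h : m ≤ n) {z} (hz : ℓ.P n z) : ℓ.P m z := by
  obtain ⟨k, rfl⟩ := Int.le.dest h
  clear h
  induction k with
  | zero => simpa using hz
  | succ k ih =>
    apply ih
    apply Hs_chain _ _ (ℓ.a (m + k + 1))
    rw [← ℓ.hc]
    unfold P at hz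
    push_cast at hz
    rwa [← add_assoc] at hz

theorem P_c (ℓ : Line) (m n : ℤ) : ℓ.P m (ℓ.c n) ↔ m < n := by
  constructor
  · intro h
    by_contra hc
    exact not_Hs_self _ _ (ℓ.P_anti (not_lt.1 hc) h)
  · intro h
    have : ℓ.P (n - 1) (ℓ.c n) := by
      have := Hs_next (ℓ.c (n - 1)) (ℓ.a (n - 1))
      rwa [← ℓ.hc, sub_add_cancel] at this
    exact ℓ.P_anti (by omega) this

theorem c_inj (ℓ : Line) {m n : ℤ} (h : ℓ.c m = ℓ.c n) : m = n := by
  rcases lt_trichotomy m n with h1 | h1 | h1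
  · rw [← P_c ℓ, ← h, P_c] at h1; omega
  · exact h1
  · rw [← P_c ℓ, h, P_c] at h1; omega

theorem rel (ℓ : Line) (m n : ℤ) :
    Rel (fun g i => ∃ t, ℓ.c t = g ∧ ℓ.a t = i) (ℓ.c m) (ℓ.c n) := by
  have key : ∀ (m : ℤ) (k : ℕ),
      Rel (fun g i => ∃ t, ℓ.c t = g ∧ ℓ.a t = i) (ℓ.c m) (ℓ.c (m + k)) := by
    intro m k
    induction k with
    | zero => simpa using Rel.refl _
    | succ k ih =>
      refine ih.trans ?_
      push_cast
      rw [← add_assoc, ℓ.hc]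
      exact Rel.step ⟨_, rfl, rfl⟩
  rcases le_total m n with h | h
  · obtain ⟨k, rfl⟩ := Int.le.dest h
    exact key m k
  · obtain ⟨k, rfl⟩ := Int.le.dest h
    exact (key n k).symm

theorem same {ℓ ℓ' : Line} {s s' : ℤ} (h1 : ℓ'.c s' = ℓ.c s) (h2 : ℓ'.a s' = ℓ.a s)
    (h3 : ℓ'.a (s' + 1) = ℓ.a (s + 1)) : ∃ k, ℓ' = ℓ.shift k := by
  refine ⟨s - s', ?_⟩
  have key : ∀ n : ℤ, ℓ'.c (s' + n) = ℓ.c (s + n) ∧ ℓ'.a (s' + n) = ℓ.a (s + n) ∧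
      ℓ'.a (s' + n + 1) = ℓ.a (s + n + 1) := by
    intro n
    induction n using Int.induction_on with
    | zero => simp [h1, h2, h3]
    | succ n ih =>
      obtain ⟨i1, i2, i3⟩ := ih
      rw [← add_assoc, ← add_assoc, hc, hc, i1, i2, i3]
      refine ⟨rfl, rfl, ?_⟩
      rw [add_assoc _ 1 1, add_assoc _ 1 1]
      exact (ha _ _).trans (i2.trans (ha _ _).symm)
    | pred n ih =>
      obtain ⟨i1, i2, i3⟩ := ih
      have e : ∀ x : ℤ, x + (-n - 1) = x + -n - 1 := by intro x; ring
      rw [e, e, sub_add_cancel, sub_add_cancel]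
      have hA : ℓ'.a (s' + -n - 1) = ℓ.a (s + -n - 1) := by
        rw [← ha, ← ha ℓ]
        convert i3 using 2 <;> ring
      refine ⟨?_, hA, i2⟩
      have := hc ℓ (s + -n - 1)
      have h' := hc ℓ' (s' + -n - 1)
      rw [sub_add_cancel] at this h'
      rw [this, h', hA] at i1
      exact mul_right_cancel i1
  ext n
  · have := (key (n - s')).1
    simp only [shift_c]
    convert this using 2 <;> ring
  · have := (key (n - s')).2.1
    simp only [shift_a]
    convert this using 2 <;> ring

/-- If two consecutive edges of `ℓ` separate two vertices of `ℓ'`, the lines coincide. -/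
theorem same_of_sep {ℓ ℓ' : Line} {s m n : ℤ} (h1 : ¬ (ℓ.P s (ℓ'.c m) ↔ ℓ.P s (ℓ'.c n)))
    (h2 : ¬ (ℓ.P (s + 1) (ℓ'.c m) ↔ ℓ.P (s + 1) (ℓ'.c n))) : ∃ k, ℓ' = ℓ.shift k := by
  obtain ⟨t1, a1, b1⟩ := ℓ'.rel m n _ _ h1
  obtain ⟨t2, a2, b2⟩ := ℓ'.rel m n _ _ h2
  have : t2 = t1 + 1 := by
    apply ℓ'.c_inj
    rw [a2, hc, hc, a1, b1]
  subst this
  exact same a1 b1 b2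

end Line

open Classical in
/-- relator lengths -/
noncomputable def pr (T : SimpleGraph ℕ) (i j : ℕ) : ℕ :=
  if i = j then 7 else if T.Adj i j then 22 else 26

theorem pr_symm (T : SimpleGraph ℕ) (i j : ℕ) : pr T i j = pr T j i := by
  unfold pr
  have h : T.Adj i j ↔ T.Adj j i := T.adj_comm i j
  have h2 : i = j ↔ j = i := eq_comm
  by_cases h3 : T.Adj j i <;> by_cases h4 : j = i <;> simp [h, h2, h3, h4]

theorem pr_ge (T : SimpleGraph ℕ) (i j : ℕ) : 7 ≤ pr T i j := by
  unfold pr; split_ifs <;> norm_num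

namespace Line

variable (T : SimpleGraph ℕ)

noncomputable def len (ℓ : Line) : ℤ := pr T (ℓ.a 0) (ℓ.a 1)

theorem len_ge (ℓ : Line) : 7 ≤ ℓ.len T := by
  unfold len; exact_mod_cast pr_ge T _ _

theorem a_even (ℓ : Line) (n k : ℤ) : ℓ.a (n + 2 * k) = ℓ.a n := by
  induction k using Int.induction_on with
  | zero => simp
  | succ k ih => rw [← ih, ← ha ℓ (n + 2 * k)]; congr 1; ring
  | pred k ih => rw [← ih, ← ha]; congr 1; ring

theorem a_const (ℓ : Line) (h : ℓ.a 0 = ℓ.a 1) (n : ℤ) : ℓ.a n = ℓ.a 0 := by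
  rcases Int.even_or_odd' n with ⟨k, rfl | rfl⟩
  · rw [← a_even ℓ 0 k, zero_add]
  · rw [h, ← a_even ℓ 1 k, add_comm]

theorem len_eq (ℓ : Line) (n : ℤ) : ℓ.len T = pr T (ℓ.a n) (ℓ.a (n + 1)) := by
  unfold len
  rcases Int.even_or_odd' n with ⟨k, rfl | rfl⟩
  · rw [← a_even ℓ 0 k, ← a_even ℓ 1 k, zero_add, add_comm 1]
  · rw [← a_even ℓ 0 (k + 1), ← a_even ℓ 1 k, pr_symm]
    congr 3 <;> ring

theorem a_len (ℓ : Line) (n : ℤ) : ℓ.a (n + ℓ.len T) = ℓ.a n := by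
  by_cases h : ℓ.a 0 = ℓ.a 1
  · rw [a_const ℓ h, a_const ℓ h n]
  · unfold len pr
    rw [if_neg h]
    split_ifs
    · exact a_even ℓ n 11
    · exact a_even ℓ n 13

noncomputable def r (ℓ : Line) : FreeGroup ℕ := ℓ.c (ℓ.len T) * (ℓ.c 0)⁻¹

theorem r_c (ℓ : Line) (n : ℤ) : ℓ.r T * ℓ.c n = ℓ.c (n + ℓ.len T) := by
  induction n using Int.induction_on with
  | zero => simp [r]
  | succ n ih =>
    rw [hc, ← mul_assoc, ih, add_right_comm, hc, a_len]
  | pred n ih =>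
    have := hc ℓ (-n - 1)
    have h' := hc ℓ (-n - 1 + ℓ.len T)
    rw [sub_add_cancel] at this
    rw [a_len, show (-n - 1 + ℓ.len T + 1) = -n + ℓ.len T by ring, ← ih, this, ← mul_assoc] at h'
    exact mul_right_cancel h'

theorem rpow_c (ℓ : Line) (p n : ℤ) : ℓ.r T ^ p * ℓ.c n = ℓ.c (n + p * ℓ.len T) := by
  induction p using Int.induction_on generalizing n with
  | zero => simp
  | succ p ih =>
    rw [zpow_add_one, mul_assoc, r_c, ih]
    congr 1; ring
  | pred p ih =>
    have h := r_c T ℓ (n - ℓ.len T)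
    rw [sub_add_cancel] at h
    rw [← h, ← mul_assoc, zpow_sub_one, inv_mul_cancel_right, ih]
    congr 1; ring

theorem r_shift (ℓ : Line) (k : ℤ) : (ℓ.shift k).r T = ℓ.r T := by
  have h1 : (ℓ.shift k).len T = ℓ.len T := by
    rw [len_eq T ℓ k]; unfold len; simp [add_comm]
  unfold r
  rw [h1]
  simp only [shift_c, zero_add]
  rw [add_comm, ← r_c]
  unfold r
  group

theorem r_tr (ℓ : Line) (h) : (ℓ.tr h).r T = h * ℓ.r T * h⁻¹ := by
  unfold r
  simp [len, mul_assoc]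

theorem tr_rpow (ℓ : Line) (p : ℤ) : ℓ.tr (ℓ.r T ^ p) = ℓ.shift (p * ℓ.len T) := by
  ext n
  · simp [rpow_c]
  · simp only [tr_a, shift_a]
    induction p using Int.induction_on with
    | zero => simp
    | succ p ih => rw [ih, add_mul, one_mul, ← add_assoc, a_len]
    | pred p ih =>
      rw [ih, sub_mul, one_mul]
      rw [← a_len T ℓ (n + (-↑p * len T ℓ - len T ℓ))]
      congr 1; ring

theorem P_rpow (ℓ : Line) (p n : ℤ) (z) :
    ℓ.P (n + p * ℓ.len T) (ℓ.r T ^ p * z) ↔ ℓ.P n z := by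
  rw [← P_shift, ← tr_rpow, P_tr]

end Line

end Wm


namespace Wm

open FreeGroup

/-- The windmill invariant. -/
structure Wind (T : SimpleGraph ℕ) (W : Set (FreeGroup ℕ)) (H : Subgroup (FreeGroup ℕ)) :
    Prop where
  one : 1 ∈ W
  smul : ∀ h ∈ H, ∀ w ∈ W, h * w ∈ W
  conn : Conn W
  sat : ∀ ℓ : Line, ℓ.c 0 ∈ W → ℓ.c 1 ∈ W → ℓ.c 2 ∈ W → (∀ n, ℓ.c n ∈ W) ∧ ℓ.r T ∈ H

/-- normalized non-saturated lines meeting `W` -/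
structure SS (W : Set (FreeGroup ℕ)) (ℓ : Line) : Prop where
  h0 : ℓ.c 0 ∈ W
  hm : ℓ.c (-1) ∉ W
  h2 : ℓ.c 2 ∉ W

/-- outer part of a line -/
def UU (ℓ : Line) (z : FreeGroup ℕ) : Prop := ℓ.P 2 z ∨ ¬ ℓ.P (-2) z

theorem UU_tr (ℓ : Line) (h z) : UU (ℓ.tr h) (h * z) ↔ UU ℓ z := by
  unfold UU; rw [Line.P_tr, Line.P_tr]

inductive NF (T : SimpleGraph ℕ) (W : Set (FreeGroup ℕ)) (H : Subgroup (FreeGroup ℕ)) :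
    FreeGroup ℕ → Prop
  | base (h) : h ∈ H → NF T W H h
  | step (ℓ : Line) (p : ℤ) (x : FreeGroup ℕ) : SS W ℓ → p ≠ 0 → NF T W H x → (∀ w ∈ W, ¬ UU ℓ (x * w)) →
      NF T W H (ℓ.r T ^ p * x)

/-- the next group -/
def nextH (T : SimpleGraph ℕ) (W : Set (FreeGroup ℕ)) (H : Subgroup (FreeGroup ℕ)) :
    Subgroup (FreeGroup ℕ) :=
  H ⊔ Subgroup.closure {x | ∃ ℓ, SS W ℓ ∧ x = ℓ.r T}

/-- the next set -/
def nextW (T : SimpleGraph ℕ) (W : Set (FreeGroup ℕ)) (H : Subgroup (FreeGroup ℕ)) :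
    Set (FreeGroup ℕ) :=
  {z | ∃ x ∈ nextH T W H, ∃ v, z = x * v ∧ (v ∈ W ∨ ∃ ℓ n, SS W ℓ ∧ v = ℓ.c n)}

variable {T : SimpleGraph ℕ} {W : Set (FreeGroup ℕ)} {H : Subgroup (FreeGroup ℕ)}

namespace Wind

theorem P_neg (hW : Wind T W H) {ℓ : Line} (hl : SS W ℓ) {w} (hw : w ∈ W) : ℓ.P (-1) w := by
  by_contra hc
  have h0 : ℓ.P (-1) (ℓ.c 0) := by rw [Line.P_c]; norm_num
  exact hl.hm (hW.conn _ hl.h0 _ hw _ _ (fun e => hc (e.1 h0))).1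

theorem P_pos (hW : Wind T W H) {ℓ : Line} (hl : SS W ℓ) {w} (hw : w ∈ W) : ¬ ℓ.P 1 w := by
  intro hc
  have h0 : ¬ ℓ.P 1 (ℓ.c 0) := by rw [Line.P_c]; norm_num
  have := (hW.conn _ hl.h0 _ hw _ _ (fun e => h0 (e.2 hc))).2
  rw [← Line.hc] at this
  exact hl.h2 this

theorem P_pos' (hW : Wind T W H) {ℓ : Line} (hl : SS W ℓ) {t : ℤ} (ht : 1 ≤ t)
    (hn : ℓ.c t ∉ W) {w} (hw : w ∈ W) : ¬ ℓ.P (t - 1) w := by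
  intro hc
  have h0 : ¬ ℓ.P (t - 1) (ℓ.c 0) := by rw [Line.P_c]; omega
  have := (hW.conn _ hl.h0 _ hw _ _ (fun e => h0 (e.2 hc))).2
  rw [← Line.hc, sub_add_cancel] at this
  exact hn this

theorem not_UU (hW : Wind T W H) {ℓ : Line} (hl : SS W ℓ) {w} (hw : w ∈ W) : ¬ UU ℓ w := by
  rintro (h | h)
  · exact hW.P_pos hl hw (ℓ.P_anti (by norm_num) h)
  · exact h (ℓ.P_anti (by norm_num) (hW.P_neg hl hw))

theorem SS_tr (hW : Wind T W H) {ℓ : Line} (hl : SS W ℓ) {h} (hh : h ∈ H) : SS W (ℓ.tr h) := by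
  have key : ∀ x, h * x ∈ W → x ∈ W := by
    intro x hx
    have := hW.smul h⁻¹ (H.inv_mem hh) _ hx
    simpa using this
  exact ⟨hW.smul h hh _ hl.h0, fun e => hl.hm (key _ e), fun e => hl.h2 (key _ e)⟩

theorem SS_eq (hW : Wind T W H) {ℓ ℓ' : Line} (hl : SS W ℓ) (hl' : SS W ℓ')
    (h : ∃ k, ℓ' = ℓ.shift k) : ℓ' = ℓ := by
  obtain ⟨k, rfl⟩ := h
  have h0 := hl'.h0
  have hm := hl'.hm
  simp only [Line.shift_c, zero_add] at h0 hm
  have h1 := hW.P_neg hl h0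
  have h2 := hW.P_pos hl h0
  rw [Line.P_c] at h1 h2
  have : k = 0 ∨ k = 1 := by omega
  rcases this with rfl | rfl
  · exact Line.shift_zero _
  · exact absurd hl.h0 hm

theorem not_UU_line (hW : Wind T W H) {ℓ ℓ' : Line} (hl : SS W ℓ) (hl' : SS W ℓ')
    (hne : ℓ' ≠ ℓ) (n : ℤ) : ¬ UU ℓ (ℓ'.c n) := by
  rintro (h | h)
  · apply hne
    apply hW.SS_eq hl hl'
    have h0 := hW.P_pos hl hl'.h0
    refine Line.same_of_sep (s := 1) (m := 0) (n := n) (fun e => h0 (e.2 ?_)) (fun e => h0 ?_)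
    · exact ℓ.P_anti (by norm_num) h
    · exact ℓ.P_anti (by norm_num) (e.2 h)
  · apply hne
    apply hW.SS_eq hl hl'
    have h0 := hW.P_neg hl hl'.h0
    refine Line.same_of_sep (s := -2) (m := 0) (n := n) (fun e => h (e.1 ?_)) (fun e => h ?_)
    · exact ℓ.P_anti (by norm_num) h0
    · exact ℓ.P_anti (by norm_num) (e.1 h0)

theorem UU_SH {ℓ : Line} {z} (h : UU ℓ z) :
    ∃ t b, z ∈ SH (ℓ.c t) (ℓ.a t) b ∧ ∀ y, y ∈ SH (ℓ.c t) (ℓ.a t) b → UU ℓ y := by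
  rcases h with h | h
  · exact ⟨2, true, by simpa [SH, Line.P] using h, fun y hy => Or.inl (by simpa [SH, Line.P] using hy)⟩
  · exact ⟨-2, false, by simpa [SH, Line.P] using h, fun y hy => Or.inr (by simpa [SH, Line.P] using hy)⟩

theorem UU_disj (hW : Wind T W H) {ℓ ℓ' : Line} (hl : SS W ℓ) (hl' : SS W ℓ')
    (hne : ℓ' ≠ ℓ) {z} (h : UU ℓ z) : ¬ UU ℓ' z := by
  intro h'
  obtain ⟨t, b, h1, h2⟩ := UU_SH h
  obtain ⟨t', b', h1', h2'⟩ := UU_SH h'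
  have key := hW.not_UU_line hl hl' hne
  have key' := hW.not_UU_line hl' hl hne.symm
  refine SH_disj ?_ ?_ ?_ ?_ z h1 h1'
  · exact fun e => key' _ (h2' _ e)
  · rw [← Line.hc]; exact fun e => key' _ (h2' _ e)
  · exact fun e => key _ (h2 _ e)
  · rw [← Line.hc]; exact fun e => key _ (h2 _ e)

theorem UU_pow (T : SimpleGraph ℕ) {ℓ : Line} {p : ℤ} (hp : p ≠ 0) {z} (h : ¬ UU ℓ z) :
    UU ℓ (ℓ.r T ^ p * z) := by
  unfold UU at *
  push Not at h
  have hL := ℓ.len_ge T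
  rcases lt_or_gt_of_ne hp with h1 | h1
  · right
    intro hc
    apply h.1
    rw [← Line.P_rpow T ℓ p]
    apply ℓ.P_anti _ hc
    nlinarith
  · left
    have := h.2
    rw [← Line.P_rpow T ℓ p] at this
    apply ℓ.P_anti _ this
    nlinarith

theorem NF_H (hW : Wind T W H) {x} (hx : NF T W H x) : ∀ h ∈ H, NF T W H (h * x) := by
  induction hx with
  | base k hk => exact fun h hh => NF.base _ (H.mul_mem hh hk)
  | step ℓ p x hl hp hx hU ih =>
    intro h hh
    have := NF.step (T := T) (ℓ.tr h) p (h * x) (hW.SS_tr hl hh) hp (ih h hh) (by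
      intro w hw
      rw [mul_assoc, UU_tr]
      exact hU w hw)
    rw [Line.r_tr, conj_zpow] at this
    convert this using 1
    group

theorem NF_r (hW : Wind T W H) {x} (hx : NF T W H x) {ℓ : Line} (hl : SS W ℓ) (q : ℤ) :
    NF T W H (ℓ.r T ^ q * x) := by
  by_cases hq : q = 0
  · simpa [hq] using hx
  cases hx with
  | base k hk =>
    exact NF.step ℓ q x hl hq (NF.base _ hk) (fun w hw => hW.not_UU hl (hW.smul _ hk _ hw))
  | step ℓ' p x' hl' hp hx' hU =>
    by_cases he : ℓ' = ℓ
    · subst he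
      rw [← mul_assoc, ← zpow_add]
      by_cases hpq : q + p = 0
      · simpa [hpq] using hx'
      · exact NF.step _ _ _ hl hpq hx' hU
    · refine NF.step _ _ _ hl hq (NF.step _ _ _ hl' hp hx' hU) ?_
      intro w hw
      rw [mul_assoc]
      exact hW.UU_disj hl' hl (Ne.symm he) (UU_pow T hp (hU w hw))

theorem nextH_induction {p : FreeGroup ℕ → Prop} (h1 : p 1) (hH : ∀ h ∈ H, ∀ x, p x → p (h * x))
    (hr : ∀ ℓ, SS W ℓ → ∀ (q : ℤ) x, p x → p (ℓ.r T ^ q * x)) {x} (hx : x ∈ nextH T W H) :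
    p x := by
  have : nextH T W H = Subgroup.closure ((H : Set (FreeGroup ℕ)) ∪ {x | ∃ ℓ, SS W ℓ ∧ x = ℓ.r T}) := by
    rw [Subgroup.closure_union, Subgroup.closure_eq]; rfl
  rw [this] at hx
  induction hx using Subgroup.closure_induction_left with
  | one => exact h1
  | mul_left x hx y _ ih =>
    rcases hx with hx | ⟨ℓ, hl, rfl⟩
    · exact hH x hx y ih
    · simpa using hr ℓ hl 1 y ih
  | inv_mul_cancel x hx y _ ih =>
    rcases hx with hx | ⟨ℓ, hl, rfl⟩
    · exact hH x⁻¹ (H.inv_mem hx) y ih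
    · simpa using hr ℓ hl (-1) y ih

theorem NF_all (hW : Wind T W H) {x} (hx : x ∈ nextH T W H) : NF T W H x :=
  nextH_induction (NF.base _ H.one_mem) (fun h hh _ hx => hW.NF_H hx h hh)
    (fun _ hl q _ hx => hW.NF_r hx hl q) hx

theorem H_le : H ≤ nextH T W H := le_sup_left

theorem r_mem {ℓ : Line} (hl : SS W ℓ) : ℓ.r T ∈ nextH T W H :=
  (le_sup_right : _ ≤ nextH T W H) (Subgroup.subset_closure ⟨ℓ, hl, rfl⟩)

/-- The separation conclusion. -/
theorem concl (hW : Wind T W H) {x} (hx : x ∈ nextH T W H) (hx' : x ∉ H) :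
    ∃ ℓ : Line, (¬ ℓ.P 1 1 ∧ ℓ.P (ℓ.len T - 2) x) ∨ (ℓ.P (-1) 1 ∧ ¬ ℓ.P (- ℓ.len T + 2) x) := by
  cases hW.NF_all hx with
  | base k hk => exact absurd hk hx'
  | step ℓ p x' hl hp hx' hU =>
    have h := hU 1 hW.one
    rw [mul_one] at h
    unfold UU at h
    push Not at h
    have hL := ℓ.len_ge T
    refine ⟨ℓ, ?_⟩
    rcases lt_or_gt_of_ne hp with h1 | h1
    · right
      refine ⟨hW.P_neg hl hW.one, ?_⟩
      intro hc
      apply h.1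
      rw [← Line.P_rpow T ℓ p]
      apply ℓ.P_anti _ hc
      nlinarith
    · left
      refine ⟨hW.P_pos hl hW.one, ?_⟩
      have := h.2
      rw [← Line.P_rpow T ℓ p] at this
      apply ℓ.P_anti _ this
      nlinarith

/-- edges of the next set -/
def EE (T : SimpleGraph ℕ) (W : Set (FreeGroup ℕ)) (H : Subgroup (FreeGroup ℕ))
    (g : FreeGroup ℕ) (i : ℕ) : Prop :=
  ∃ x ∈ nextH T W H, (x * g ∈ W ∧ x * g * of i ∈ W) ∨
    ∃ ℓ t, SS W ℓ ∧ x * g = ℓ.c t ∧ i = ℓ.a t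

theorem EE_smul {u g i} (hu : u ∈ nextH T W H) (h : EE T W H g i) : EE T W H (u * g) i := by
  obtain ⟨x, hx, h⟩ := h
  refine ⟨x * u⁻¹, mul_mem hx (inv_mem hu), ?_⟩
  rwa [mul_assoc, inv_mul_cancel_left]

theorem EE_next {g i} (h : EE T W H g i) : g ∈ nextW T W H ∧ g * of i ∈ nextW T W H := by
  obtain ⟨x, hx, h⟩ := h
  rcases h with ⟨h1, h2⟩ | ⟨ℓ, t, hl, h1, rfl⟩
  · exact ⟨⟨x⁻¹, inv_mem hx, _, by group, Or.inl h1⟩, ⟨x⁻¹, inv_mem hx, _, by group, Or.inl h2⟩⟩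
  · refine ⟨⟨x⁻¹, inv_mem hx, _, by group, Or.inr ⟨ℓ, t, hl, h1⟩⟩,
      ⟨x⁻¹, inv_mem hx, x * g * of (ℓ.a t), by group, Or.inr ⟨ℓ, t + 1, hl, ?_⟩⟩⟩
    rw [h1, Line.hc]

theorem EE_W (hW : Wind T W H) {v w} (hv : v ∈ W) (hw : w ∈ W) : Rel (EE T W H) v w :=
  (hW.conn v hv w hw).mono fun g i h => ⟨1, one_mem _, Or.inl (by simpa using h)⟩

theorem EE_l {ℓ : Line} (hl : SS W ℓ) (m n : ℤ) : Rel (EE T W H) (ℓ.c m) (ℓ.c n) :=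
  (ℓ.rel m n).mono fun g i h => ⟨1, one_mem _, Or.inr (by
    obtain ⟨t, h1, h2⟩ := h
    exact ⟨ℓ, t, hl, by simp [h1], h2.symm⟩)⟩

theorem EE_rel (hW : Wind T W H) {z} (hz : z ∈ nextW T W H) : Rel (EE T W H) 1 z := by
  obtain ⟨x, hx, v, rfl, hv⟩ := hz
  have h1 : Rel (EE T W H) 1 v := by
    rcases hv with hv | ⟨ℓ, n, hl, rfl⟩
    · exact hW.EE_W hW.one hv
    · exact (hW.EE_W hW.one hl.h0).trans (EE_l hl _ _)
  have hsm : ∀ {u x y}, u ∈ nextH T W H → Rel (EE T W H) x y → Rel (EE T W H) (u * x) (u * y) :=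
    fun hu h => h.smul _ (fun g i => EE_smul hu)
  have h2 : Rel (EE T W H) 1 x := by
    refine nextH_induction (p := fun x => Rel (EE T W H) 1 x) (Rel.refl _) ?_ ?_ hx
    · intro h hh y hy
      have := hsm (H_le hh) hy
      rw [mul_one] at this
      refine Rel.trans (hW.EE_W hW.one ?_) this
      simpa using hW.smul h hh 1 hW.one
    · intro ℓ hl q y hy
      have hm : ℓ.r T ^ q ∈ nextH T W H := zpow_mem (r_mem hl) q
      refine Rel.trans ?_ (hsm hm hy)
      refine (hW.EE_W hW.one hl.h0).trans ?_
      refine (EE_l hl 0 (0 + q * ℓ.len T)).trans ?_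
      rw [← Line.rpow_c]
      exact hsm hm (hW.EE_W hl.h0 hW.one)
  refine h2.trans ?_
  have := hsm hx h1
  rwa [mul_one] at this

theorem meets (hW : Wind T W H) {ℓ : Line} {n : ℤ} (h : ℓ.c n ∈ W) :
    ((∀ n, ℓ.c n ∈ W) ∧ ℓ.r T ∈ H) ∨ ∃ k, SS W (ℓ.shift k) := by
  by_cases hs : ∃ m, ℓ.c m ∈ W ∧ ℓ.c (m + 1) ∈ W ∧ ℓ.c (m + 2) ∈ W
  · left
    obtain ⟨m, h0, h1, h2⟩ := hs
    have := hW.sat (ℓ.shift m) (by simpa using h0) (by simpa [add_comm] using h1)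
      (by simpa [add_comm] using h2)
    rw [Line.r_shift] at this
    refine ⟨fun n => ?_, this.2⟩
    have := this.1 (n - m)
    simpa using this
  · right
    push Not at hs
    by_cases h1 : ℓ.c (n - 1) ∈ W
    · have a1 := hs (n - 1) h1 (by simpa using h)
      have a2 : ℓ.c (n - 2) ∉ W := by
        intro a2
        refine hs (n - 2) a2 ?_ ?_
        · convert h1 using 2; ring
        · simpa using h
      exact ⟨n - 1, by simpa using h1, by rw [Line.shift_c]; convert a2 using 2; ring_nf,
        by rw [Line.shift_c]; convert a1 using 2; ring_nf⟩
    · refine ⟨n, by simpa using h, by rw [Line.shift_c]; convert h1 using 2; ring_nf, ?_⟩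
      intro h2
      rw [Line.shift_c, add_comm] at h2
      have := hW.conn _ h _ h2 (ℓ.c n) (ℓ.a n) (by
        have a := ℓ.P_c n n
        have b := ℓ.P_c n (n + 2)
        unfold Line.P at a b
        rw [a, b]; omega)
      have h3 := this.2
      rw [← Line.hc] at h3
      exact hs n h h3 h2

theorem lemM (hW : Wind T W H) {x} (hx : NF T W H x) {Z : Line} (hZ : SS W Z) :
    ∀ {ℓ : Line}, SS W ℓ → (∀ w ∈ W, ¬ UU ℓ (x * w)) →
      (∃ k, Z.tr x = ℓ.shift k) ∨ ∀ n, ¬ UU ℓ (x * Z.c n) := by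
  induction hx with
  | base h hh =>
    intro ℓ hl _
    by_cases he : Z.tr h = ℓ
    · left; exact ⟨0, by rw [he, Line.shift_zero]⟩
    · right; exact hW.not_UU_line hl (hW.SS_tr hZ hh) he
  | step m p x' hm hp hx' hU ih =>
    intro ℓ hl hU'
    right
    have hne : m ≠ ℓ := by
      rintro rfl
      apply hU' 1 hW.one
      rw [mul_assoc]
      exact UU_pow T hp (hU 1 hW.one)
    rcases ih hm hU with ⟨k, hk⟩ | h
    · intro n
      have e : m.r T ^ p * x' * Z.c n = m.c (n + p * m.len T + k) := by
        rw [mul_assoc, ← Line.tr_c Z, hk, Line.shift_c, Line.rpow_c]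
        congr 1; ring
      rw [e]
      exact hW.not_UU_line hl hm hne _
    · intro n
      rw [mul_assoc]
      exact hW.UU_disj hm hl hne.symm (UU_pow T hp (h n))

theorem lemK (hW : Wind T W H) {x} (hx : NF T W H x) {Z : Line} (hZ : SS W Z)
    {Z1 : Line} (hZ1 : SS W Z1) :
    ∀ {s s' : ℤ}, Z1.c s = x * Z.c s' →
      ∃ (p k : ℤ) (Z' : Line), SS W Z' ∧ Z.tr x = (Z'.shift k).tr (Z1.r T ^ p) := by
  induction hx with
  | base h hh =>
    intro s s' _
    exact ⟨0, 0, Z.tr h, hW.SS_tr hZ hh, by simp [Line.shift_zero, Line.tr_one]⟩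
  | step m p x' hm hp hx' hU ih =>
    intro s s' he
    by_cases hne : Z1 = m
    · subst hne
      obtain ⟨q, k, Z', h1, h2⟩ := ih (s := s + (-p) * Z1.len T) (s' := s') (by
        rw [← Line.rpow_c, he]; group)
      refine ⟨p + q, k, Z', h1, ?_⟩
      rw [← Line.tr_tr, h2, Line.tr_tr, zpow_add]
    · rcases hW.lemM hx' hZ hm hU with ⟨k, hk⟩ | h
      · refine ⟨0, p * m.len T + k, m, hm, ?_⟩
        rw [← Line.tr_tr, hk, Line.tr_shift, Line.tr_rpow, Line.shift_shift, zpow_zero, Line.tr_one,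
          add_comm]
      · have := UU_pow T hp (h s')
        rw [← mul_assoc, ← he] at this
        exact absurd this (hW.not_UU_line hm hZ1 hne s)

/-- translates of lines of the family are fine -/
theorem good_of {Y Z : Line} {x} (hx : x ∈ nextH T W H) {k : ℤ} (hZ : SS W Z)
    (h : Y.tr x = Z.shift k) : (∀ n, Y.c n ∈ nextW T W H) ∧ Y.r T ∈ nextH T W H := by
  constructor
  · intro n
    refine ⟨x⁻¹, inv_mem hx, Z.c (n + k), ?_, Or.inr ⟨Z, _, hZ, rfl⟩⟩
    rw [← Line.shift_c, ← h, Line.tr_c, inv_mul_cancel_left]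
  · have := Line.r_tr T Y x
    rw [h, Line.r_shift] at this
    have e : Y.r T = x⁻¹ * Z.r T * x := by rw [this]; group
    rw [e]
    exact mul_mem (mul_mem (inv_mem hx) (r_mem hZ)) hx

theorem good_W (hW : Wind T W H) {Y : Line} {x} (hx : x ∈ nextH T W H) {n : ℤ}
    (h : x * Y.c n ∈ W) : (∀ n, Y.c n ∈ nextW T W H) ∧ Y.r T ∈ nextH T W H := by
  rcases hW.meets (ℓ := Y.tr x) h with ⟨h1, h2⟩ | ⟨k, hk⟩
  · constructor
    · intro n
      refine ⟨x⁻¹, inv_mem hx, x * Y.c n, by group, Or.inl (h1 n)⟩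
    · rw [Line.r_tr] at h2
      have e : Y.r T = x⁻¹ * (x * Y.r T * x⁻¹) * x := by group
      rw [e]
      exact mul_mem (mul_mem (inv_mem hx) (H_le h2)) hx
  · refine good_of hx (k := -k) hk ?_
    rw [Line.shift_shift, neg_add_cancel, Line.shift_zero]

theorem next (hW : Wind T W H) : Wind T (nextW T W H) (nextH T W H) where
  one := ⟨1, one_mem _, 1, by simp, Or.inl hW.one⟩
  smul := by
    rintro h hh w ⟨x, hx, v, rfl, hv⟩
    exact ⟨h * x, mul_mem hh hx, v, by group, hv⟩
  conn := fun x hx y hy =>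
    ((hW.EE_rel hx).symm.trans (hW.EE_rel hy)).mono fun _ _ h => EE_next h
  sat := by
    intro Y h0 h1 h2
    have hE : ∀ t, Y.c t ∈ nextW T W H → Y.c (t + 1) ∈ nextW T W H → EE T W H (Y.c t) (Y.a t) := by
      intro t h0 h1
      refine (hW.EE_rel h0).symm.trans (hW.EE_rel h1) _ _ ?_
      have a := Y.P_c t t
      have b := Y.P_c t (t + 1)
      unfold Line.P at a b
      rw [a, b]; omega
    obtain ⟨x, hx, e0⟩ := hE 0 h0 h1
    obtain ⟨x', hx', e1⟩ := hE 1 h1 h2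
    rcases e0 with e0 | ⟨Z1, s, hZ1, e0, e0'⟩
    · exact hW.good_W hx e0.1
    rcases e1 with e1 | ⟨Z2, s', hZ2, e1, e1'⟩
    · exact hW.good_W hx' e1.1
    -- intersection
    have f1 : x * Y.c 1 = Z1.c (s + 1) := by
      have := Y.hc 0
      rw [zero_add] at this
      rw [this, ← mul_assoc, e0, Line.hc, e0']
    have f2 : Z1.c (s + 1) = x * x'⁻¹ * Z2.c s' := by
      rw [← f1, ← e1]; group
    obtain ⟨p, k, Z', hZ', hk⟩ := hW.lemK (hW.NF_all (mul_mem hx (inv_mem hx'))) hZ2 hZ1 f2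
    -- translate everything by `u⁻¹ x`
    obtain ⟨y, hy⟩ : ∃ y, y = Z1.r T ^ (-p) * x := ⟨_, rfl⟩
    have hyx : y ∈ nextH T W H := by
      rw [hy]; exact mul_mem (zpow_mem (r_mem hZ1) _) hx
    obtain ⟨t, ht⟩ : ∃ t, t = s + (-p) * Z1.len T := ⟨_, rfl⟩
    have g0 : (Y.tr y).c 0 = Z1.c t := by
      rw [Line.tr_c, hy, mul_assoc, e0, Line.rpow_c, ht]
    have g0' : (Y.tr y).a 0 = Z1.a t := by
      rw [Line.tr_a, e0', ht]
      have := congrArg (fun l => l.a s) (Line.tr_rpow T Z1 (-p))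
      simpa using this
    obtain ⟨t', ht'⟩ : ∃ t', t' = s' + k := ⟨_, rfl⟩
    have g1 : (Y.tr y).c 1 = Z'.c t' := by
      have := congrArg (fun l => l.c s') hk
      simp only [Line.tr_c, Line.shift_c] at this
      rw [← f2, ← f1] at this
      rw [Line.tr_c, hy, mul_assoc, this, ht']
      group
    have g1' : (Y.tr y).a 1 = Z'.a t' := by
      have := congrArg (fun l => l.a s') hk
      simp only [Line.tr_a, Line.shift_a] at this
      rw [Line.tr_a, e1', this, ht']
    generalize hY : Y.tr y = Y' at g0 g0' g1 g1'
    have g2 : Z1.c (t + 1) = Z'.c t' := by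
      rw [Line.hc, ← g0, ← g0', ← g1, ← Line.hc, zero_add]
    by_cases hyW : Z'.c t' ∈ W
    · rw [← g1, ← hY] at hyW
      exact hW.good_W hyx hyW
    have hne : t + 1 ≠ 0 := by
      intro h
      rw [h] at g2
      exact hyW (g2 ▸ hZ1.h0)
    rcases lt_or_gt_of_ne hne with hlt | hgt
    · -- outgoing edge of Z1
      have a1 : Z1.P (t + 1) (Z'.c 0) := Z1.P_anti (by omega) (hW.P_neg hZ1 hZ'.h0)
      have a2 : ¬ Z1.P (t + 1) (Z'.c t') := by rw [← g2, Line.P_c]; omega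
      obtain ⟨m, b1, b2⟩ := Z'.rel 0 t' _ _ (fun e => a2 (e.1 a1))
      have : m = t' := Z'.c_inj (b1.trans g2)
      subst this
      obtain ⟨k, hk⟩ := Line.same (ℓ := Z1) (ℓ' := Y') (s := t) (s' := 0) g0 g0'
        (by rw [zero_add, g1', b2])
      exact good_of hyx hZ1 (hY.trans hk)
    · have a1 : ¬ Z1.P (t + 1 - 1) (Z'.c 0) :=
        hW.P_pos' hZ1 (by omega) (by rwa [g2]) hZ'.h0
      have a2 : Z1.P (t + 1 - 1) (Z'.c t') := by rw [← g2, Line.P_c]; omega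
      obtain ⟨m, b1, b2⟩ := Z'.rel 0 t' _ _ (fun e => a1 (e.2 a2))
      rw [add_sub_cancel_right] at b1 b2
      have : m + 1 = t' := Z'.c_inj (by rw [Line.hc, b1, b2, ← Line.hc, g2])
      subst this
      obtain ⟨k, hk⟩ := Line.same (ℓ := Z') (ℓ' := Y') (s := m) (s' := 0) (g0.trans b1.symm)
        (g0'.trans b2.symm) (by rw [zero_add, g1'])
      exact good_of hyx hZ' (hY.trans hk)

end Wind

end Wm


namespace Wm

open FreeGroup

theorem wind_zero (T : SimpleGraph ℕ) : Wind T {1} ⊥ where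
  one := rfl
  smul := by
    rintro h hh w hw
    rw [Subgroup.mem_bot] at hh
    simpa [hh] using hw
  conn := by
    rintro x rfl y rfl
    exact Rel.refl _
  sat := by
    intro ℓ h0 h1 _
    have : (0 : ℤ) = 1 := ℓ.c_inj ((Set.mem_singleton_iff.1 h0).trans (Set.mem_singleton_iff.1 h1).symm)
    norm_num at this

/-- the sequence of windmills -/
def ws (T : SimpleGraph ℕ) : ℕ → Set (FreeGroup ℕ) × Subgroup (FreeGroup ℕ)
  | 0 => ({1}, ⊥)
  | k + 1 => (nextW T (ws T k).1 (ws T k).2, nextH T (ws T k).1 (ws T k).2)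

theorem ws_wind (T : SimpleGraph ℕ) (k : ℕ) : Wind T (ws T k).1 (ws T k).2 := by
  induction k with
  | zero => exact wind_zero T
  | succ k ih => exact ih.next

/-- the explicit line -/
def ml (g : FreeGroup ℕ) (i j : ℕ) : Line where
  c n := g * (of i * of j) ^ (n / 2) * (if n % 2 = 0 then 1 else of i)
  a n := if n % 2 = 0 then i else j
  hc n := by
    rcases Int.even_or_odd' n with ⟨k, rfl | rfl⟩
    · have h1 : (2 * k + 1) / 2 = k := by omega
      have h2 : (2 * k + 1) % 2 = 1 := by omega
      have h3 : (2 * k) / 2 = k := by omega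
      have h4 : (2 * k) % 2 = 0 := by omega
      rw [h1, h2, h3, h4]; simp
    · have h1 : (2 * k + 1) / 2 = k := by omega
      have h2 : (2 * k + 1) % 2 = 1 := by omega
      have h3 : (2 * k + 1 + 1) / 2 = k + 1 := by omega
      have h4 : (2 * k + 1 + 1) % 2 = 0 := by omega
      rw [h1, h2, h3, h4, zpow_add_one]; simp [mul_assoc]
  ha n := by
    have : (n + 2) % 2 = n % 2 := by omega
    rw [this]

theorem ws_mono_W (T : SimpleGraph ℕ) (k : ℕ) {w} (h : w ∈ (ws T k).1) : w ∈ (ws T (k + 1)).1 :=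
  ⟨1, one_mem _, w, by simp, Or.inl h⟩

theorem ws_line (T : SimpleGraph ℕ) (k : ℕ) {Y : Line} {n : ℤ} (h : Y.c n ∈ (ws T k).1) :
    (∀ n, Y.c n ∈ (ws T (k + 1)).1) ∧ Y.r T ∈ (ws T (k + 1)).2 :=
  (ws_wind T k).good_W (one_mem _) (n := n) (by simpa using h)

theorem ws_all (T : SimpleGraph ℕ) (g : FreeGroup ℕ) : ∃ k, g ∈ (ws T k).1 := by
  have key : ∀ L : List (ℕ × Bool), ∃ k, mk L ∈ (ws T k).1 := by
    intro L
    induction L using List.reverseRecOn with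
    | nil => exact ⟨0, rfl⟩
    | append_singleton L s ih =>
      obtain ⟨k, hk⟩ := ih
      refine ⟨k + 1, ?_⟩
      have h := (ws_line T k (Y := ml (mk L) s.1 s.1) (n := 0) (by simpa [ml] using hk)).1
      rw [← mul_mk]
      rcases s with ⟨i, b⟩
      cases b
      · convert h (-1) using 1
        change mk L * (of i)⁻¹ = _
        simp [ml, mul_assoc]
      · convert h 1 using 1
        simp [ml]
        rfl
  obtain ⟨k, hk⟩ := key g.toWord
  exact ⟨k, by rwa [mk_toWord] at hk⟩

theorem ws_H_mono (T : SimpleGraph ℕ) : Monotone (fun k => (ws T k).2) :=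
  monotone_nat_of_le_succ fun _ => Wind.H_le

theorem ws_exhaust (T : SimpleGraph ℕ) {n : FreeGroup ℕ}
    (hn : n ∈ Subgroup.normalClosure (grRels T.Adj)) : ∃ k, n ∈ (ws T k).2 := by
  rw [← Subgroup.mem_iSup_of_directed (ws_H_mono T).directed_le]
  revert n
  change Subgroup.normalClosure (grRels T.Adj) ≤ _
  unfold Subgroup.normalClosure
  rw [Subgroup.closure_le]
  intro x hx
  obtain ⟨r, hr, hc⟩ := Group.mem_conjugatesOfSet_iff.1 hx
  obtain ⟨g, rfl⟩ := isConj_iff.1 hc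
  obtain ⟨k, hk⟩ := ws_all T g
  suffices h : ∃ Y : Line, Y.c 0 = g ∧ Y.r T = g * r * g⁻¹ by
    obtain ⟨Y, h1, h2⟩ := h
    have := (ws_line T k (Y := Y) (n := 0) (h1 ▸ hk)).2
    rw [h2] at this
    exact (le_iSup (fun k => (ws T k).2) (k + 1)) this
  rcases hr with ⟨i, rfl⟩ | ⟨i, j, hij, rfl⟩ | ⟨i, j, hne, hij, rfl⟩
  · refine ⟨ml g i i, by simp [ml], ?_⟩
    have : (ml g i i).len T = 7 := by simp [Line.len, ml, pr]
    rw [Line.r, this]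
    simp [ml]
    simp only [pow_succ, pow_zero, one_mul, mul_assoc]
  · refine ⟨ml g i j, by simp [ml], ?_⟩
    have : (ml g i j).len T = 22 := by simp [Line.len, ml, pr, hij, hij.ne]
    rw [Line.r, this]
    simp [ml]
  · refine ⟨ml g i j, by simp [ml], ?_⟩
    have : (ml g i j).len T = 26 := by simp [Line.len, ml, pr, hij, hne]
    rw [Line.r, this]
    simp [ml]

/-- alternating words -/
def altL (i j : ℕ) : ℕ → List (ℕ × Bool)
  | 0 => []
  | k + 1 => (i, true) :: altL j i k

theorem P_word (ℓ : Line) (z : FreeGroup ℕ) (k : ℕ) : ∀ s : ℤ, ℓ.P (s + k) z →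
    ∃ R, ((ℓ.c s)⁻¹ * z).toWord = altL (ℓ.a s) (ℓ.a (s + 1)) (k + 1) ++ R := by
  induction k with
  | zero =>
    intro s h
    simp only [Line.P, Hs, Nat.cast_zero, add_zero] at h
    obtain ⟨t, ht⟩ := List.head?_eq_some_iff.1 h
    exact ⟨t, by simp [ht, altL]⟩
  | succ k ih =>
    intro s h
    have h1 : ℓ.P s z := ℓ.P_anti (by omega) h
    obtain ⟨R, hR⟩ := ih (s + 1) (by
      convert h using 1; push_cast; ring)
    obtain ⟨t, ht⟩ := List.head?_eq_some_iff.1 h1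
    have ht' : IsReduced t := (isReduced_toWord (x := (ℓ.c s)⁻¹ * z)).infix
      ⟨[(ℓ.a s, true)], [], by simp [ht]⟩
    have e : (ℓ.c (s + 1))⁻¹ * z = mk t := by
      have : (ℓ.c s)⁻¹ * z = of (ℓ.a s) * mk t := by
        rw [← mk_toWord (x := (ℓ.c s)⁻¹ * z), ht]; rfl
      rw [Line.hc, mul_inv_rev, mul_assoc, this, inv_mul_cancel_left]
    rw [e, toWord_of_reduced ht', show s + 1 + 1 = s + 2 by ring, Line.ha ℓ s] at hR
    refine ⟨R, ?_⟩
    rw [ht, hR]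
    rfl

theorem P_seg (ℓ : Line) (z : FreeGroup ℕ) (k : ℕ) (s : ℤ) (h1 : ¬ ℓ.P s 1)
    (h2 : ℓ.P (s + k) z) : altL (ℓ.a s) (ℓ.a (s + 1)) (k + 1) <:+: z.toWord := by
  obtain ⟨R, hR⟩ := P_word ℓ z k s h2
  have e : z = mk ((ℓ.c s).toWord ++ ((ℓ.c s)⁻¹ * z).toWord) := by
    rw [← mul_mk, mk_toWord, mk_toWord]; group
  have hr : IsReduced ((ℓ.c s).toWord ++ ((ℓ.c s)⁻¹ * z).toWord) := by
    apply isReduced_append isReduced_toWord isReduced_toWord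
    rintro ⟨x, b⟩ ha y hb hab
    rw [hR] at hb
    simp [altL] at hb
    subst hb
    simp at hab
    subst hab
    cases b
    · exfalso
      apply h1
      unfold Line.P Hs
      obtain ⟨t, ht⟩ := List.getLast?_eq_some_iff.1 ha
      simp [toWord_inv, ht, invRev]
    · rfl
  rw [e, toWord_of_reduced hr, hR]
  exact ⟨(ℓ.c s).toWord, R, by simp⟩

/-- Greendlinger's lemma. -/
theorem greend (T : SimpleGraph ℕ) {n : FreeGroup ℕ}
    (hn : n ∈ Subgroup.normalClosure (grRels T.Adj)) (h1 : n ≠ 1) :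
    ∃ i j, altL i j (pr T i j - 2) <:+: n.toWord ∨ altL i j (pr T i j - 2) <:+: n⁻¹.toWord := by
  classical
  have hex := ws_exhaust T hn
  have hk := Nat.find_spec hex
  cases hk' : Nat.find hex with
  | zero =>
    rw [hk'] at hk
    exact absurd (Subgroup.mem_bot.1 hk) h1
  | succ k =>
    rw [hk'] at hk
    have hnot : n ∉ (ws T k).2 := Nat.find_min hex (by omega)
    obtain ⟨ℓ, ⟨a1, a2⟩ | ⟨a1, a2⟩⟩ := (ws_wind T k).concl hk hnot
    · have hL := ℓ.len_eq T 1
      have := pr_ge T (ℓ.a 1) (ℓ.a (1 + 1))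
      have := P_seg ℓ n (pr T (ℓ.a 1) (ℓ.a (1 + 1)) - 3) 1 a1 (by
        convert a2 using 1; omega)
      refine ⟨ℓ.a 1, ℓ.a (1 + 1), Or.inl ?_⟩
      convert this using 2
      omega
    · obtain ⟨s, hs⟩ : ∃ s, s = - ℓ.len T + 2 := ⟨_, rfl⟩
      have hL := ℓ.len_eq T s
      have := pr_ge T (ℓ.a s) (ℓ.a (s + 1))
      rw [← hs] at a2
      rw [← Line.P_tr ℓ n⁻¹] at a1 a2
      rw [inv_mul_cancel] at a2
      rw [mul_one] at a1
      have := P_seg (ℓ.tr n⁻¹) n⁻¹ (pr T (ℓ.a s) (ℓ.a (s + 1)) - 3) s a2 (by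
        convert a1 using 1; omega)
      refine ⟨ℓ.a s, ℓ.a (s + 1), Or.inr ?_⟩
      rw [show pr T (ℓ.a s) (ℓ.a (s + 1)) - 2 = pr T (ℓ.a s) (ℓ.a (s + 1)) - 3 + 1 by omega]
      exact this

end Wm


namespace Wm

open FreeGroup

/-- signed alternating words -/
def altS (b : Bool) (i j : ℕ) : ℕ → List (ℕ × Bool)
  | 0 => []
  | k + 1 => (i, b) :: altS b j i k

theorem altS_length (b : Bool) (k : ℕ) : ∀ i j, (altS b i j k).length = k := by
  induction k with
  | zero => intros; rfl
  | succ k ih => intro i j; simp [altS, ih]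

theorem altS_get (b : Bool) (k : ℕ) : ∀ i j t, t < k →
    (altS b i j k)[t]? = some (if t % 2 = 0 then i else j, b) := by
  induction k with
  | zero => intro i j t h; omega
  | succ k ih =>
    intro i j t h
    cases t with
    | zero => simp [altS]
    | succ t =>
      simp only [altS, List.getElem?_cons_succ]
      rw [ih j i t (by omega)]
      rcases Nat.mod_two_eq_zero_or_one t with h | h
      · have : (t + 1) % 2 = 1 := by omega
        simp [h, this]
      · have : (t + 1) % 2 = 0 := by omega
        simp [h, this]

theorem altL_eq (k : ℕ) : ∀ i j, altL i j k = altS true i j k := by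
  induction k with
  | zero => intros; rfl
  | succ k ih => intro i j; simp [altS, altL, ih]

theorem altS_add (b : Bool) (k l : ℕ) : ∀ i j,
    ∃ i' j', altS b i j (k + l) = altS b i j k ++ altS b i' j' l := by
  induction k with
  | zero => intro i j; exact ⟨i, j, by simp [altS]⟩
  | succ k ih =>
    intro i j
    obtain ⟨i', j', h⟩ := ih j i
    exact ⟨i', j', by rw [show k + 1 + l = k + l + 1 by ring]; simp [altS, h]⟩

theorem altS_two (b : Bool) (k : ℕ) : ∀ i j,
    altS b i j (k + 2) = (i, b) :: (j, b) :: altS b i j k := by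
  intros; rfl

theorem altS_snoc (b : Bool) (k : ℕ) : ∀ i j,
    altS b i j (k + 1) = altS b i j k ++ [(if k % 2 = 0 then i else j, b)] := by
  induction k with
  | zero => intros; rfl
  | succ k ih =>
    intro i j
    rw [altS, ih j i, altS]
    rcases Nat.mod_two_eq_zero_or_one k with h | h
    · have : (k + 1) % 2 = 1 := by omega
      simp [h, this]
    · have : (k + 1) % 2 = 0 := by omega
      simp [h, this]

theorem invRev_altS (b : Bool) (k : ℕ) : ∀ i j,
    ∃ i' j', (i' = i ∧ j' = j ∨ i' = j ∧ j' = i) ∧ invRev (altS b i j k) = altS (!b) i' j' k := by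
  intro i j
  have : invRev (altS b i j k) = if k % 2 = 0 then altS (!b) j i k else altS (!b) i j k := by
    induction k with
    | zero => rfl
    | succ k ih =>
      rw [altS_snoc, invRev_append, ih]
      rcases Nat.mod_two_eq_zero_or_one k with h | h
      · have : (k + 1) % 2 = 1 := by omega
        simp [h, this, invRev, altS]
      · have : (k + 1) % 2 = 0 := by omega
        simp [h, this, invRev, altS]
  rw [this]
  split_ifs
  · exact ⟨j, i, by simp, rfl⟩
  · exact ⟨i, j, by simp, rfl⟩

theorem invRev_seg {L M : List (ℕ × Bool)} (h : L <:+: M) : invRev L <:+: invRev M := by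
  obtain ⟨A, B, rfl⟩ := h
  exact ⟨invRev B, invRev A, by simp [invRev_append, List.append_assoc]⟩

theorem greendS (T : SimpleGraph ℕ) {n : FreeGroup ℕ}
    (hn : n ∈ Subgroup.normalClosure (grRels T.Adj)) (h1 : n ≠ 1) :
    ∃ b i j, altS b i j (pr T i j - 2) <:+: n.toWord := by
  obtain ⟨i, j, h | h⟩ := greend T hn h1
  · exact ⟨true, i, j, by rwa [← altL_eq]⟩
  · rw [toWord_inv] at h
    have := invRev_seg h
    rw [invRev_invRev, altL_eq] at this
    obtain ⟨i', j', hij, e⟩ := invRev_altS true (pr T i j - 2) i j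
    rw [e] at this
    refine ⟨false, i', j', ?_⟩
    rcases hij with ⟨rfl, rfl⟩ | ⟨rfl, rfl⟩
    · exact this
    · rw [pr_symm]; exact this

/-- the projection -/
def pj (T : SimpleGraph ℕ) : FreeGroup ℕ →* GT T.Adj := PresentedGroup.mk (grRels T.Adj)

variable (T : SimpleGraph ℕ)

theorem pj_of (i : ℕ) : pj T (of i) = gen T.Adj i := rfl

theorem pj_surj : Function.Surjective (pj T) := PresentedGroup.mk_surjective _

theorem pj_eq_one {x : FreeGroup ℕ} :
    pj T x = 1 ↔ x ∈ Subgroup.normalClosure (grRels T.Adj) :=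
  PresentedGroup.mk_eq_one_iff

theorem pj_rel {x : FreeGroup ℕ} (h : x ∈ grRels T.Adj) : pj T x = 1 :=
  (pj_eq_one T).2 (Subgroup.subset_normalClosure h)

theorem gen7 (i : ℕ) : gen T.Adj i ^ 7 = 1 := by
  rw [← pj_of, ← _root_.map_pow]
  exact pj_rel T (Or.inl ⟨i, rfl⟩)

theorem gen11 {i j : ℕ} (h : T.Adj i j) : (gen T.Adj i * gen T.Adj j) ^ 11 = 1 := by
  rw [← pj_of, ← pj_of, ← _root_.map_mul, ← _root_.map_pow]
  exact pj_rel T (Or.inr (Or.inl ⟨i, j, h, rfl⟩))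

theorem gen13 {i j : ℕ} (hne : i ≠ j) (h : ¬ T.Adj i j) :
    (gen T.Adj i * gen T.Adj j) ^ 13 = 1 := by
  rw [← pj_of, ← pj_of, ← _root_.map_mul, ← _root_.map_pow]
  exact pj_rel T (Or.inr (Or.inr ⟨i, j, hne, h, rfl⟩))

theorem mk_altS_even (b : Bool) (i j m : ℕ) :
    mk (altS b i j (2 * m)) = (mk [(i, b)] * mk [(j, b)]) ^ m := by
  induction m with
  | zero => rfl
  | succ m ih =>
    rw [show 2 * (m + 1) = 2 * m + 2 by ring, altS_two, pow_succ', ← ih]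
    rfl

theorem mk_altS_self (b : Bool) (i m : ℕ) :
    mk (altS b i i m) = mk [(i, b)] ^ m := by
  induction m with
  | zero => rfl
  | succ m ih =>
    rw [pow_succ', ← ih]
    rfl

theorem pj_false (i : ℕ) : pj T (mk [(i, false)]) = (gen T.Adj i)⁻¹ := by
  change pj T (of i)⁻¹ = _
  rw [_root_.map_inv, pj_of]

theorem pj_true (i : ℕ) : pj T (mk [(i, true)]) = gen T.Adj i := rfl

theorem gen_pow_pair {i j : ℕ} (hne : i ≠ j) :
    ∃ m, pr T i j = 2 * m ∧ (m = 11 ∨ m = 13) ∧ (gen T.Adj i * gen T.Adj j) ^ m = 1 := by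
  by_cases h : T.Adj i j
  · exact ⟨11, by simp [pr, hne, h], by simp, gen11 T h⟩
  · exact ⟨13, by simp [pr, hne, h], by simp, gen13 T hne h⟩

theorem pj_altS_pr (b : Bool) (i j : ℕ) : pj T (mk (altS b i j (pr T i j))) = 1 := by
  by_cases h : i = j
  · subst h
    have : pr T i i = 7 := by simp [pr]
    rw [this, mk_altS_self, _root_.map_pow]
    cases b
    · rw [pj_false, inv_pow, gen7, inv_one]
    · rw [pj_true, gen7]
  · cases b
    · obtain ⟨m, h1, _, h2⟩ := gen_pow_pair T (Ne.symm h)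
      rw [pr_symm, h1, mk_altS_even, _root_.map_pow, _root_.map_mul, pj_false, pj_false, ← mul_inv_rev, inv_pow,
        h2, inv_one]
    · obtain ⟨m, h1, _, h2⟩ := gen_pow_pair T h
      rw [h1, mk_altS_even, _root_.map_pow, _root_.map_mul, pj_true, pj_true, h2]

/-- Shortening. -/
theorem shorten {b : Bool} {i j : ℕ} {w : List (ℕ × Bool)}
    (h : altS b i j (pr T i j - 2) <:+: w) :
    ∃ y : FreeGroup ℕ, pj T y = pj T (mk w) ∧ y.norm + pr T i j ≤ w.length + 4 := by
  obtain ⟨A, B, rfl⟩ := h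
  have h7 := pr_ge T i j
  obtain ⟨i', j', e⟩ := altS_add b (pr T i j - 2) 2 i j
  have e1 := pj_altS_pr T b i j
  rw [show pr T i j = pr T i j - 2 + 2 by omega, e, ← mul_mk, _root_.map_mul] at e1
  have e2 := eq_inv_of_mul_eq_one_left e1
  refine ⟨mk A * (mk (altS b i' j' 2))⁻¹ * mk B, ?_, ?_⟩
  · rw [← mul_mk, ← mul_mk]
    simp only [_root_.map_mul, _root_.map_inv]
    rw [← e2]
  · have a1 := norm_mul_le (mk A * (mk (altS b i' j' 2))⁻¹) (mk B)
    have a2 := norm_mul_le (mk A) (mk (altS b i' j' 2))⁻¹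
    have a3 := norm_mk_le (L₁ := A)
    have a4 := norm_mk_le (L₁ := B)
    have a5 := norm_mk_le (L₁ := altS b i' j' 2)
    rw [norm_inv_eq] at a2
    rw [altS_length] at a5
    simp only [List.length_append, altS_length]
    omega

/-- cyclic windows -/
def Win (R w : List (ℕ × Bool)) (s : ℕ) : Prop :=
  ∀ t < R.length, R[t]? = w[(s + t) % w.length]?

theorem flatten_get (w : List (ℕ × Bool)) (n : ℕ) : ∀ t, t < n * w.length →
    (List.replicate n w).flatten[t]? = w[t % w.length]? := by
  induction n with
  | zero => intro t h; omega
  | succ n ih =>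
    intro t h
    rw [List.replicate_succ, List.flatten_cons]
    by_cases ht : t < w.length
    · rw [List.getElem?_append_left ht, Nat.mod_eq_of_lt ht]
    · rw [List.getElem?_append_right (by omega), ih _ (by rw [add_mul] at h; omega),
        ← Nat.mod_eq_sub_mod (by omega)]

theorem win_of_seg {R w : List (ℕ × Bool)} {n : ℕ} (h : R <:+: (List.replicate n w).flatten)
    (hw : w ≠ []) : ∃ s < w.length, Win R w s := by
  have hpos : 0 < w.length := List.length_pos_of_ne_nil hw
  obtain ⟨A, B, h⟩ := h
  refine ⟨A.length % w.length, Nat.mod_lt _ hpos, ?_⟩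
  intro t ht
  have hl := congrArg List.length h
  simp only [List.length_append, List.length_flatten, List.map_replicate, List.sum_replicate, smul_eq_mul] at hl
  have := flatten_get w n (A.length + t) (by omega)
  rw [← h, List.append_assoc, List.getElem?_append_right (by omega),
    List.getElem?_append_left (by omega)] at this
  rw [Nat.mod_add_mod, ← this]
  congr 1; omega

theorem infix_of_get {R w : List (ℕ × Bool)} {s : ℕ}
    (h : ∀ t < R.length, R[t]? = w[s + t]?) : R <:+: w := by
  by_cases hR : R = []
  · subst hR; exact List.nil_infix
  have e : R = (w.drop s).take R.length := by
    apply List.ext_getElem?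
    intro t
    by_cases ht : t < R.length
    · rw [h t ht, List.getElem?_take_of_lt ht, List.getElem?_drop]
    · rw [List.getElem?_eq_none (by omega), List.getElem?_eq_none (by simp; omega)]
  rw [e]
  exact (List.take_prefix _ _).isInfix.trans (List.drop_suffix _ _).isInfix

theorem Win.rotate {R w : List (ℕ × Bool)} {s : ℕ} (h : Win R w s) (k s' : ℕ)
    (hs : (s' + k) % w.length = s % w.length) : Win R (w.rotate k) s' := by
  intro t ht
  rw [h t ht, List.length_rotate]
  by_cases hw : w = []
  · subst hw; simp
  have hpos : 0 < w.length := List.length_pos_of_ne_nil hw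
  rw [List.getElem?_rotate (Nat.mod_lt _ hpos), Nat.mod_add_mod, add_right_comm, Nat.add_mod, ← hs, ← Nat.add_mod]

theorem Win.seg {R w : List (ℕ × Bool)} {s : ℕ} (h : Win R w s) (hs : s + R.length ≤ w.length) :
    R <:+: w := by
  apply infix_of_get (s := s)
  intro t ht
  rw [h t ht, Nat.mod_eq_of_lt (by omega)]

theorem mk_rotate (w : List (ℕ × Bool)) (k : ℕ) : IsConj (mk w) (mk (w.rotate k)) := by
  rw [List.rotate_eq_drop_append_take_mod, ← mul_mk]
  conv_lhs => rw [← List.take_append_drop (k % w.length) w, ← mul_mk]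
  rw [isConj_iff]
  exact ⟨(mk (w.take (k % w.length)))⁻¹, by group⟩

/-- powers of a cyclically reduced nonempty word which is torsion contain a long window -/
theorem torsion_win {w : List (ℕ × Bool)} (hw : IsCyclicallyReduced w) (hne : w ≠ []) {n : ℕ}
    (hn : n ≠ 0) (h : pj T (mk w) ^ n = 1) :
    ∃ b i j, ∃ s < w.length, Win (altS b i j (pr T i j - 2)) w s := by
  rw [← _root_.map_pow, pj_eq_one] at h
  have hw1 : (mk w).toWord = w := toWord_of_reduced hw.isReduced
  have h1 : mk w ≠ 1 := by
    intro e
    rw [e, toWord_one] at hw1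
    exact hne hw1.symm
  have h2 : mk w ^ n ≠ 1 := by
    intro e
    exact h1 ((pow_eq_one_iff_left hn).1 e)
  obtain ⟨b, i, j, hR⟩ := greendS T h h2
  rw [toWord_pow, hw1, (hw.flatten_replicate n).isReduced.reduce_eq] at hR
  exact ⟨b, i, j, win_of_seg hR hne⟩

end Wm


namespace Wm

open FreeGroup

variable (T : SimpleGraph ℕ)

theorem mk_opp {a b : ℕ × Bool} (h1 : a.1 = b.1) (h2 : a.2 ≠ b.2) :
    mk [a] = (mk [b])⁻¹ := by
  rcases a with ⟨a, e⟩
  rcases b with ⟨b, f⟩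
  simp at h1 h2
  subst h1
  rw [inv_mk]
  congr 1
  cases e <;> cases f <;> simp [invRev] at h2 ⊢

theorem isCyc_of_min {x : FreeGroup ℕ}
    (h : ∀ y, IsConj (pj T x) (pj T y) → x.norm ≤ y.norm) : IsCyclicallyReduced x.toWord := by
  rw [isCyclicallyReduced_iff]
  refine ⟨isReduced_toWord, ?_⟩
  intro a ha b hb h1
  by_contra h2
  obtain ⟨L, hL⟩ := List.head?_eq_some_iff.1 hb
  obtain ⟨L', hL'⟩ := List.getLast?_eq_some_iff.1 ha
  cases L' with
  | nil =>
    rw [hL] at hL'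
    simp at hL'
    exact h2 (by rw [hL'.1])
  | cons c M =>
    rw [hL] at hL'
    simp at hL'
    obtain ⟨rfl, rfl⟩ := hL'
    have e : x = mk [b] * mk M * (mk [b])⁻¹ := by
      rw [← mk_opp h1 h2, mul_mk, mul_mk, ← mk_toWord (x := x), hL]; rfl
    have := h (mk M) (by
      rw [e, isConj_comm, isConj_iff]
      exact ⟨pj T (mk [b]), by simp only [_root_.map_mul, _root_.map_inv]⟩)
    have h3 := norm_mk_le (L₁ := M)
    have h4 : x.norm = (M ++ [a]).length + 1 := by rw [FreeGroup.norm, hL]; rfl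
    simp at h4
    omega

theorem torsion_conj {g : GT T.Adj} {n : ℕ} (hn : n ≠ 0) (hg : g ^ n = 1) (h1 : g ≠ 1) :
    (∃ i, ∃ k : ℤ, IsConj g (gen T.Adj i ^ k)) ∨
    (∃ i j, ∃ k : ℤ, i ≠ j ∧ IsConj g ((gen T.Adj i * gen T.Adj j) ^ k)) := by
  classical
  have hex : ∃ m, ∃ x : FreeGroup ℕ, x.norm = m ∧ IsConj g (pj T x) := by
    obtain ⟨x, rfl⟩ := pj_surj T g
    exact ⟨_, x, rfl, IsConj.refl _⟩
  obtain ⟨x, hx1, hx2⟩ := Nat.find_spec hex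
  have hmin : ∀ y, IsConj (pj T x) (pj T y) → x.norm ≤ y.norm := by
    intro y hy
    rw [hx1]
    exact Nat.find_min' hex ⟨y, rfl, hx2.trans hy⟩
  have hcyc := isCyc_of_min T hmin
  have hne : x.toWord ≠ [] := by
    intro h
    rw [toWord_eq_nil_iff] at h
    subst h
    rw [_root_.map_one, isConj_one_left] at hx2
    exact h1 hx2
  have hxn : pj T (mk x.toWord) ^ n = 1 := by
    rw [mk_toWord]
    obtain ⟨c, hc⟩ := isConj_iff.1 hx2
    rw [← hc, conj_pow, hg]; simp
  obtain ⟨b, i, j, s, hs, hwin⟩ := torsion_win T hcyc hne hn hxn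
  generalize hw : x.toWord = w at *
  have hconj : IsConj (pj T x) (pj T (mk (w.rotate s))) := by
    have := MonoidHom.map_isConj (pj T) (mk_rotate w s)
    rw [← hw, mk_toWord] at this
    rw [← hw]
    exact this
  have hwin' : Win (altS b i j (pr T i j - 2)) (w.rotate s) 0 := hwin.rotate s 0 (by simp)
  have h7 := pr_ge T i j
  have hnorm : x.norm = w.length := by rw [FreeGroup.norm, hw]
  by_cases hlen : pr T i j - 2 ≤ w.length
  · exfalso
    have hin := hwin'.seg (by simpa [altS_length] using hlen)
    obtain ⟨y, hy1, hy2⟩ := shorten T hin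
    rw [← hy1] at hconj
    have := hmin y hconj
    rw [List.length_rotate] at hy2
    omega
  · have e : w.rotate s = altS b i j w.length := by
      apply List.ext_getElem?
      intro t
      by_cases ht : t < w.length
      · have := hwin' t (by rw [altS_length]; omega)
        rw [List.length_rotate, zero_add, Nat.mod_eq_of_lt ht] at this
        rw [← this, altS_get _ _ _ _ _ ht, altS_get _ _ _ _ _ (by omega)]
      · rw [List.getElem?_eq_none (by simp; omega), List.getElem?_eq_none (by simp [altS_length]; omega)]
    rw [e] at hconj
    replace hconj := hx2.trans hconj
    by_cases hij : i = j
    · left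
      subst hij
      rw [mk_altS_self, _root_.map_pow] at hconj
      cases b
      · rw [pj_false] at hconj
        exact ⟨i, -w.length, by simpa using hconj⟩
      · rw [pj_true] at hconj
        exact ⟨i, w.length, by simpa using hconj⟩
    · right
      have hev : w.length % 2 = 0 := by
        have a1 := hwin' 0 (by rw [altS_length]; omega)
        have a2 := hwin' w.length (by rw [altS_length]; omega)
        rw [List.length_rotate, zero_add, Nat.mod_self] at a2
        rw [List.length_rotate, zero_add, Nat.zero_mod, ← a2, altS_get _ _ _ _ _ (by omega),
          altS_get _ _ _ _ _ (by omega)] at a1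
        by_contra hc
        simp [hc] at a1
        exact hij a1
      obtain ⟨m, hm⟩ : ∃ m, w.length = 2 * m := ⟨w.length / 2, by omega⟩
      rw [hm, mk_altS_even, _root_.map_pow, _root_.map_mul] at hconj
      cases b
      · rw [pj_false, pj_false, ← mul_inv_rev] at hconj
        exact ⟨j, i, -m, Ne.symm hij, by rw [zpow_neg, zpow_natCast, ← inv_pow]; exact hconj⟩
      · rw [pj_true, pj_true] at hconj
        exact ⟨i, j, m, hij, by simpa using hconj⟩

/-- short words are nontrivial -/
theorem short_ne {x : FreeGroup ℕ} (h : x.norm < 5) (h1 : x ≠ 1) : pj T x ≠ 1 := by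
  intro hx
  rw [pj_eq_one] at hx
  obtain ⟨b, i, j, hR⟩ := greendS T hx h1
  have := hR.length_le
  rw [altS_length] at this
  have := pr_ge T i j
  unfold FreeGroup.norm at h
  omega

theorem gen_ne_one (i : ℕ) : gen T.Adj i ≠ 1 := by
  rw [← pj_of]
  exact short_ne T (by simp) (of_ne_one i)

theorem pj_ne_of_word {w : List (ℕ × Bool)} (h : IsReduced w) (h1 : w.length < 5) (h2 : w ≠ []) :
    pj T (mk w) ≠ 1 := by
  have := toWord_of_reduced h
  apply short_ne
  · rw [FreeGroup.norm, this]; exact h1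
  · intro e
    rw [e, toWord_one] at this
    exact h2 this.symm

theorem gen_mul_ne_one {i j : ℕ} (h : i ≠ j) : gen T.Adj i * gen T.Adj j ≠ 1 := by
  have := pj_ne_of_word T (w := [(i, true), (j, true)]) (by simp [h]) (by simp) (by simp)
  exact this

theorem gen_comm_ne {i j : ℕ} (h : i ≠ j) :
    gen T.Adj i * gen T.Adj j ≠ gen T.Adj j * gen T.Adj i := by
  have := pj_ne_of_word T (w := [(i, true), (j, true), (i, false), (j, false)])
    (by simp [h, h.symm]) (by simp) (by simp)
  intro e
  apply this
  have e2 : mk [(i, true), (j, true), (i, false), (j, false)] =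
    of i * of j * (of i)⁻¹ * (of j)⁻¹ := rfl
  rw [e2]
  simp only [_root_.map_mul, _root_.map_inv, pj_of]
  rw [e]
  group

theorem gen_zpow_eq_one {i : ℕ} {k : ℤ} (h : gen T.Adj i ^ k = 1) : (7 : ℤ) ∣ k := by
  have : orderOf (gen T.Adj i) = 7 :=
    orderOf_eq_prime (hp := ⟨by norm_num⟩) (gen7 T i) (gen_ne_one T i)
  have h2 := orderOf_dvd_iff_zpow_eq_one.2 h
  rwa [this] at h2

theorem gen_zpow_mod {i : ℕ} {k l : ℤ} (h : (7 : ℤ) ∣ k - l) :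
    gen T.Adj i ^ k = gen T.Adj i ^ l := by
  obtain ⟨c, hc⟩ := h
  have : k = l + 7 * c := by omega
  rw [this, zpow_add, zpow_mul]
  have h7 := gen7 T i
  have : gen T.Adj i ^ (7 : ℤ) = 1 := by exact_mod_cast h7
  rw [this]; simp

/-- normal form of exponents -/
theorem exp_word (a : ℕ) {k : ℤ} (hk : ¬ (7 : ℤ) ∣ k) :
    ∃ (e : Bool) (c : ℕ), 1 ≤ c ∧ c ≤ 3 ∧ (pj T (mk (List.replicate c (a, e))) = gen T.Adj a ^ k) ∧
      (c = 1 → (7 : ℤ) ∣ k - (if e then 1 else -1)) := by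
  have hrep : ∀ (e : Bool) (c : ℕ), mk (List.replicate c (a, e)) = mk [(a, e)] ^ c := by
    intro e c
    induction c with
    | zero => rfl
    | succ c ih => rw [List.replicate_succ, pow_succ', ← ih]; rfl
  have hpos : ∀ c : ℕ, (7 : ℤ) ∣ k - c →
      pj T (mk (List.replicate c (a, true))) = gen T.Adj a ^ k := by
    intro c hc
    rw [hrep, _root_.map_pow, pj_true, gen_zpow_mod T hc, zpow_natCast]
  have hneg : ∀ c : ℕ, (7 : ℤ) ∣ k - (-c : ℤ) →
      pj T (mk (List.replicate c (a, false))) = gen T.Adj a ^ k := by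
    intro c hc
    rw [hrep, _root_.map_pow, pj_false, gen_zpow_mod T hc, zpow_neg, zpow_natCast, inv_pow]
  have : k % 7 = 1 ∨ k % 7 = 2 ∨ k % 7 = 3 ∨ k % 7 = 4 ∨ k % 7 = 5 ∨ k % 7 = 6 := by omega
  rcases this with h | h | h | h | h | h
  · exact ⟨true, 1, by omega, by omega, hpos 1 (by push_cast; omega), by simp; omega⟩
  · exact ⟨true, 2, by omega, by omega, hpos 2 (by push_cast; omega), by simp⟩
  · exact ⟨true, 3, by omega, by omega, hpos 3 (by push_cast; omega), by simp⟩
  · exact ⟨false, 3, by omega, by omega, hneg 3 (by push_cast; omega), by simp⟩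
  · exact ⟨false, 2, by omega, by omega, hneg 2 (by push_cast; omega), by simp⟩
  · exact ⟨false, 1, by omega, by omega, hneg 1 (by push_cast; omega), by simp; omega⟩

end Wm


namespace Wm

open FreeGroup

variable (T : SimpleGraph ℕ)

theorem half_win {b : Bool} {i j K s : ℕ} {A G B : List (ℕ × Bool)} (hG : G ≠ [])
    (h : Win (altS b i j K) (A ++ G ++ B ++ invRev G) s) (hs : s < A.length + G.length) :
    altS b i j K <:+: A ++ G ++ B := by
  obtain ⟨G0, ⟨x, σ⟩, rfl⟩ : ∃ G0 y, G = G0 ++ [y] :=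
    ⟨_, _, (List.dropLast_append_getLast hG).symm⟩
  have hinv : invRev (G0 ++ [(x, σ)]) = (x, !σ) :: invRev G0 := by simp [invRev]
  rw [hinv] at h
  have hl : (A ++ (G0 ++ [(x, σ)]) ++ B ++ (x, !σ) :: invRev G0).length =
      A.length + G0.length + 1 + B.length + 1 + G0.length := by
    simp; omega
  simp only [List.length_append, List.length_cons, List.length_nil] at hs
  have key : s + K ≤ A.length + G0.length + 1 + B.length := by
    by_contra hc
    have h1 := h (A.length + G0.length - s) (by rw [altS_length]; omega)
    have h2 := h (A.length + G0.length + 1 + B.length - s) (by rw [altS_length]; omega)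
    rw [hl, Nat.mod_eq_of_lt (by omega), altS_get _ _ _ _ _ (by omega)] at h1 h2
    rw [show s + (A.length + G0.length - s) = A.length + G0.length by omega] at h1
    rw [show s + (A.length + G0.length + 1 + B.length - s) = A.length + G0.length + 1 + B.length by omega] at h2
    have e1 : (A ++ (G0 ++ [(x, σ)]) ++ B ++ (x, !σ) :: invRev G0)[A.length + G0.length]? = some (x, σ) := by
      rw [List.append_assoc, List.getElem?_append_left (by simp), ← List.append_assoc,
        List.getElem?_append_right (by simp)]
      simp
    have e2 : (A ++ (G0 ++ [(x, σ)]) ++ B ++ (x, !σ) :: invRev G0)[A.length + G0.length + 1 + B.length]? = some (x, !σ) := by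
      rw [List.getElem?_append_right (by simp; omega)]
      have e0 : A.length + G0.length + 1 + B.length - (A ++ (G0 ++ [(x, σ)]) ++ B).length = 0 := by
        simp; omega
      rw [e0]; rfl
    rw [e1] at h1
    rw [e2] at h2
    simp only [Option.some.injEq, Prod.mk.injEq] at h1 h2
    have := h1.2.symm.trans h2.2
    cases σ <;> simp at this
  apply infix_of_get (s := s)
  intro t ht
  rw [altS_length] at ht
  rw [h t (by rwa [altS_length]), hl, Nat.mod_eq_of_lt (by omega),
    List.getElem?_append_left (by simp; omega)]

theorem mk_rep (a : ℕ) (e : Bool) (c : ℕ) :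
    ∃ p : ℤ, pj T (mk (List.replicate c (a, e))) = gen T.Adj a ^ p := by
  have hrep : mk (List.replicate c (a, e)) = mk [(a, e)] ^ c := by
    induction c with
    | zero => rfl
    | succ c ih => rw [List.replicate_succ, pow_succ', ← ih]; rfl
  rw [hrep, _root_.map_pow]
  cases e
  · exact ⟨-c, by rw [pj_false]; simp⟩
  · exact ⟨c, by rw [pj_true]; simp⟩

/-- minimality in the double coset -/
def MinDC (a b : ℕ) (G : FreeGroup ℕ) : Prop :=
  ∀ y, (∃ p q : ℤ, pj T y = gen T.Adj a ^ p * pj T G * gen T.Adj b ^ q) → G.norm ≤ y.norm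

theorem MinDC.head {a b : ℕ} {G : FreeGroup ℕ} (h : MinDC T a b G) {x : ℕ × Bool}
    {L : List (ℕ × Bool)} (hx : G.toWord = x :: L) : x.1 ≠ a := by
  rintro rfl
  obtain ⟨a, e⟩ := x
  have e1 : mk L = (mk [(a, e)])⁻¹ * G := by
    rw [← mk_toWord (x := G), hx, eq_inv_mul_iff_mul_eq]; rfl
  have := h (mk L) (by
    rw [e1, _root_.map_mul, _root_.map_inv]
    cases e
    · exact ⟨1, 0, by rw [pj_false]; simp⟩
    · exact ⟨-1, 0, by rw [pj_true]; simp⟩)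
  have h3 := norm_mk_le (L₁ := L)
  have h4 : G.norm = L.length + 1 := by rw [FreeGroup.norm, hx]; rfl
  omega

theorem MinDC.last {a b : ℕ} {G : FreeGroup ℕ} (h : MinDC T a b G) {x : ℕ × Bool}
    {L : List (ℕ × Bool)} (hx : G.toWord = L ++ [x]) : x.1 ≠ b := by
  rintro rfl
  obtain ⟨b, e⟩ := x
  have e1 : mk L = G * (mk [(b, e)])⁻¹ := by
    rw [← mk_toWord (x := G), hx, eq_mul_inv_iff_mul_eq]; rfl
  have := h (mk L) (by
    rw [e1, _root_.map_mul, _root_.map_inv]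
    cases e
    · exact ⟨0, 1, by rw [pj_false]; simp⟩
    · exact ⟨0, -1, by rw [pj_true]; simp⟩)
  have h3 := norm_mk_le (L₁ := L)
  have h4 : G.norm = L.length + 1 := by rw [FreeGroup.norm, hx]; simp
  omega

theorem no_seg {a b : ℕ} {G : FreeGroup ℕ} (h : MinDC T a b G) (h1 : G ≠ 1)
    {c d : ℕ} (hc : c ≤ 3) (hd : d ≤ 3) (e f s : Bool) (i j : ℕ) :
    ¬ altS s i j (pr T i j - 2) <:+:
      List.replicate c (a, e) ++ G.toWord ++ List.replicate d (b, f) := by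
  intro hin
  have hgpos : 0 < G.toWord.length := by
    rw [List.length_pos_iff]
    intro h0
    exact h1 (toWord_eq_nil_iff.1 h0)
  obtain ⟨y, hy1, hy2⟩ := shorten T hin
  have hy : G.norm ≤ y.norm := by
    apply h
    obtain ⟨p, hp⟩ := mk_rep T a e c
    obtain ⟨q, hq⟩ := mk_rep T b f d
    exact ⟨p, q, by rw [hy1, ← mul_mk, ← mul_mk, mk_toWord, _root_.map_mul, _root_.map_mul, hp, hq]⟩
  have hnorm : G.norm = G.toWord.length := rfl
  simp only [List.length_append, List.length_replicate] at hy2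
  have hij : i = j := by
    by_contra hij
    obtain ⟨m, hm, hm', -⟩ := gen_pow_pair T hij
    omega
  subst hij
  have hpr : pr T i i = 7 := by simp [pr]
  rw [hpr] at hin
  obtain ⟨A', B', hAB⟩ := hin
  have hlen := congrArg List.length hAB
  simp only [List.length_append, List.length_replicate, altS_length] at hlen
  have hget : ∀ t < 5, (List.replicate c (a, e) ++ G.toWord ++ List.replicate d (b, f))[A'.length + t]?
      = some (i, s) := by
    intro t ht
    rw [← hAB, List.getElem?_append_left (by simp [altS_length]; omega),
      List.getElem?_append_right (by omega), altS_get _ _ _ _ _ (by omega)]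
    simp
  have gA : ∀ t, t < c → (List.replicate c (a, e) ++ G.toWord ++ List.replicate d (b, f))[t]? = some (a, e) := by
    intro t ht
    rw [List.getElem?_append_left (by simp; omega), List.getElem?_append_left (by simp; omega)]
    simp [ht]
  have gG : ∀ t, t < G.toWord.length → (List.replicate c (a, e) ++ G.toWord ++ List.replicate d (b, f))[c + t]? = G.toWord[t]? := by
    intro t ht
    rw [List.getElem?_append_left (by simp; omega), List.getElem?_append_right (by simp)]
    simp
  have gB : ∀ t, t < d → (List.replicate c (a, e) ++ G.toWord ++ List.replicate d (b, f))[c + G.toWord.length + t]? = some (b, f) := by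
    intro t ht
    rw [List.getElem?_append_right (by simp)]
    simp only [List.length_append, List.length_replicate, Nat.add_sub_cancel_left]
    simp [ht]
  by_cases hu : A'.length < c
  · have k1 := hget 0 (by omega)
    rw [add_zero, gA _ hu] at k1
    have k2 := hget (c - A'.length) (by omega)
    rw [show A'.length + (c - A'.length) = c + 0 by omega, gG 0 hgpos] at k2
    simp only [Option.some.injEq, Prod.mk.injEq] at k1
    rcases hG : G.toWord with _ | ⟨x, L⟩
    · rw [hG] at hgpos; simp at hgpos
    · apply h.head T hG
      rw [hG] at k2
      simp at k2
      rw [k2, k1.1]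
  by_cases hu2 : c + G.toWord.length < A'.length + 5
  · have k1 := hget 4 (by omega)
    rw [show A'.length + 4 = c + G.toWord.length + (A'.length + 4 - c - G.toWord.length) by omega,
      gB _ (by omega)] at k1
    have k2 := hget (c + G.toWord.length - 1 - A'.length) (by omega)
    rw [show A'.length + (c + G.toWord.length - 1 - A'.length) = c + (G.toWord.length - 1) by omega, gG _ (by omega)] at k2
    simp only [Option.some.injEq, Prod.mk.injEq] at k1
    obtain ⟨L, x, hG⟩ : ∃ G0 y, G.toWord = G0 ++ [y] :=
      ⟨_, _, (List.dropLast_append_getLast (List.length_pos_iff.1 hgpos)).symm⟩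
    apply h.last T hG
    rw [hG] at k2
    simp at k2
    rw [k2, k1.1]
  have hin2 : altS s i i (pr T i i - 2) <:+: G.toWord := by
    rw [hpr]
    apply infix_of_get (s := A'.length - c)
    intro t ht
    rw [altS_length] at ht
    rw [← gG _ (by omega), show c + (A'.length - c + t) = A'.length + t by omega, hget t (by omega),
      altS_get _ _ _ _ _ (by omega)]
    simp
  obtain ⟨y, hy1, hy2⟩ := shorten T hin2
  have := h y ⟨0, 0, by rw [hy1, mk_toWord]; simp⟩
  omega

theorem cyc_word {a b : ℕ} {G : FreeGroup ℕ} (h : MinDC T a b G) (h1 : G ≠ 1)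
    {c d : ℕ} (hc : 1 ≤ c) (hd : 1 ≤ d) (e f : Bool) :
    IsCyclicallyReduced (List.replicate c (a, e) ++ G.toWord ++ List.replicate d (b, f) ++
      invRev G.toWord) := by
  have hgpos : G.toWord ≠ [] := fun h0 => h1 (toWord_eq_nil_iff.1 h0)
  have hred : IsReduced G.toWord := isReduced_toWord
  have hredi : IsReduced (invRev G.toWord) := by
    rw [← toWord_inv]; exact isReduced_toWord
  have hrep : ∀ (c : ℕ) (x : ℕ × Bool), IsReduced (List.replicate c x) := by
    intro c x
    unfold FreeGroup.IsReduced
    apply List.isChain_replicate_of_rel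
    simp
  have hh : ∀ x ∈ G.toWord.head?, x.1 ≠ a := by
    intro x hx
    obtain ⟨L, hL⟩ := List.head?_eq_some_iff.1 hx
    exact h.head T hL
  have hl : ∀ x ∈ G.toWord.getLast?, x.1 ≠ b := by
    intro x hx
    obtain ⟨L, hL⟩ := List.getLast?_eq_some_iff.1 hx
    exact h.last T hL
  have hh' : ∀ x ∈ (invRev G.toWord).getLast?, x.1 ≠ a := by
    intro x hx
    simp [invRev] at hx
    obtain ⟨u, ⟨hx1, rfl⟩ | ⟨hx1, rfl⟩⟩ := hx
    · exact hh (u, false) hx1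
    · exact hh (u, true) hx1
  have hl' : ∀ x ∈ (invRev G.toWord).head?, x.1 ≠ b := by
    intro x hx
    simp [invRev] at hx
    obtain ⟨u, ⟨hx1, rfl⟩ | ⟨hx1, rfl⟩⟩ := hx
    · exact hl (u, false) hx1
    · exact hl (u, true) hx1
  have hine : invRev G.toWord ≠ [] := by
    intro h0
    apply hgpos
    have := congrArg List.length h0
    simpa using this
  have hA1 : (List.replicate c (a, e)).head? = some (a, e) := by
    rw [List.head?_replicate]; simp; omega
  have hA2 : (List.replicate c (a, e)).getLast? = some (a, e) := by
    rw [List.getLast?_replicate]; simp; omega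
  have hB1 : (List.replicate d (b, f)).head? = some (b, f) := by
    rw [List.head?_replicate]; simp; omega
  have hB2 : (List.replicate d (b, f)).getLast? = some (b, f) := by
    rw [List.getLast?_replicate]; simp; omega
  rw [isCyclicallyReduced_iff]
  constructor
  · apply isReduced_append _ hredi
    · intro x hx y hy hxy
      rw [List.getLast?_append, hB2] at hx
      simp at hx
      subst hx
      exact absurd hxy.symm (hl' y hy)
    · apply isReduced_append _ (hrep _ _)
      · intro x hx y hy hxy
        rw [hB1] at hy
        simp at hy
        subst hy
        rw [List.getLast?_append_of_ne_nil _ hgpos] at hx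
        exact absurd hxy (hl x hx)
      · apply isReduced_append (hrep _ _) hred
        intro x hx y hy hxy
        rw [hA2] at hx
        simp at hx
        subst hx
        exact absurd hxy.symm (hh y hy)
  · intro x hx y hy hxy
    rw [List.getLast?_append_of_ne_nil _ hine] at hx
    rw [List.append_assoc, List.append_assoc, List.head?_append, hA1] at hy
    simp at hy
    subst hy
    exact absurd hxy (hh' x hx)

theorem rot_word (A G B G' : List (ℕ × Bool)) :
    (A ++ G ++ B ++ G').rotate (A.length + G.length) = B ++ G' ++ A ++ G := by
  have := List.rotate_append_length_eq (A ++ G) (B ++ G')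
  rw [List.length_append] at this
  rw [List.append_assoc (A ++ G), this, List.append_assoc (B ++ G')]

theorem invRev_rep (c a : ℕ) (e : Bool) :
    invRev (List.replicate c (a, e)) = List.replicate c (a, !e) := by
  simp [invRev]

theorem conj_tor {H : Type*} [Group H] {x c : H} {n : ℕ} (h : x ^ n = 1) : (c * x * c⁻¹) ^ n = 1 := by
  rw [conj_pow, h]; simp

theorem tor_one {a b : ℕ} (hab : a ≠ b) {c d : ℕ} (hc1 : 1 ≤ c) (hc : c ≤ 3) (hd1 : 1 ≤ d)
    (hd : d ≤ 3) (e f : Bool) {n : ℕ} (hn : n ≠ 0)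
    (h : pj T (mk (List.replicate c (a, e) ++ List.replicate d (b, f))) ^ n = 1) :
    c = 1 ∧ d = 1 ∧ e = f := by
  have hrep : ∀ (c : ℕ) (x : ℕ × Bool), IsReduced (List.replicate c x) := by
    intro c x
    unfold FreeGroup.IsReduced
    apply List.isChain_replicate_of_rel
    simp
  have hA1 : (List.replicate c (a, e)).head? = some (a, e) := by
    rw [List.head?_replicate]; simp; omega
  have hA2 : (List.replicate c (a, e)).getLast? = some (a, e) := by
    rw [List.getLast?_replicate]; simp; omega
  have hB1 : (List.replicate d (b, f)).head? = some (b, f) := by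
    rw [List.head?_replicate]; simp; omega
  have hB2 : (List.replicate d (b, f)).getLast? = some (b, f) := by
    rw [List.getLast?_replicate]; simp; omega
  have hcyc : IsCyclicallyReduced (List.replicate c (a, e) ++ List.replicate d (b, f)) := by
    rw [isCyclicallyReduced_iff]
    constructor
    · apply isReduced_append (hrep _ _) (hrep _ _)
      intro x hx y hy hxy
      rw [hA2] at hx
      rw [hB1] at hy
      simp at hx hy
      subst hx hy
      exact absurd hxy hab
    · intro x hx y hy hxy
      rw [List.getLast?_append, hB2] at hx
      rw [List.head?_append, hA1] at hy
      simp at hx hy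
      subst hx hy
      exact absurd hxy.symm hab
  obtain ⟨σ, i, j, s, hs, hwin⟩ := torsion_win T hcyc (by simp; omega) hn h
  have hl : (List.replicate c (a, e) ++ List.replicate d (b, f)).length = c + d := by simp
  rw [hl] at hs
  have gA : ∀ t, t < c → (List.replicate c (a, e) ++ List.replicate d (b, f))[t]? = some (a, e) := by
    intro t ht
    rw [List.getElem?_append_left (by simp; omega)]
    simp [ht]
  have gB : ∀ t, t < d → (List.replicate c (a, e) ++ List.replicate d (b, f))[c + t]? = some (b, f) := by
    intro t ht
    rw [List.getElem?_append_right (by simp)]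
    simp [ht]
  have h7 := pr_ge T i j
  -- positions
  have hpos : ∀ u, u < c + d → ∃ t, t < c + d ∧ (s + t) % (c + d) = u := by
    intro u hu
    by_cases h : s ≤ u
    · exact ⟨u - s, by omega, by rw [Nat.mod_eq_of_lt] <;> omega⟩
    · refine ⟨u + (c + d) - s, by omega, ?_⟩
      rw [show s + (u + (c + d) - s) = u + (c + d) by omega, Nat.add_mod_right, Nat.mod_eq_of_lt hu]
  have hw : ∀ t, t < pr T i j - 2 → some (if t % 2 = 0 then i else j, σ) =
      (List.replicate c (a, e) ++ List.replicate d (b, f))[(s + t) % (c + d)]? := by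
    intro t ht
    have := hwin t (by rwa [altS_length])
    rwa [hl, altS_get _ _ _ _ _ ht] at this
  by_cases hij : i = j
  · subst hij
    exfalso
    simp only [ite_self] at hw
    have hpr : pr T i i = 7 := by simp [pr]
    rw [hpr] at hw
    by_cases hsc : s < c
    · have k1 := hw 0 (by omega)
      have k2 := hw (c - s) (by omega)
      rw [add_zero, Nat.mod_eq_of_lt hs, gA _ hsc] at k1
      rw [show s + (c - s) = c + 0 by omega, Nat.mod_eq_of_lt (by omega), gB _ (by omega)] at k2
      rw [k1] at k2
      simp at k2
      exact hab k2.1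
    · have k1 := hw 0 (by omega)
      have k2 := hw (c + d - s) (by omega)
      rw [add_zero, Nat.mod_eq_of_lt hs, show s = c + (s - c) by omega, gB _ (by omega)] at k1
      rw [show s + (c + d - s) = c + d by omega, Nat.mod_self, gA _ (by omega)] at k2
      rw [k1] at k2
      simp at k2
      exact hab k2.1.symm
  · have hK : 20 ≤ pr T i j - 2 := by
      obtain ⟨m, hm, hm', -⟩ := gen_pow_pair T hij
      omega
    have hsucc : ∀ u, u + 1 < c + d → ∀ x, (List.replicate c (a, e) ++ List.replicate d (b, f))[u]? = some x →
        (List.replicate c (a, e) ++ List.replicate d (b, f))[u + 1]? = some x → False := by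
      intro u hu x h1 h2
      obtain ⟨t, ht, htu⟩ := hpos u (by omega)
      have htu' : (s + (t + 1)) % (c + d) = u + 1 := by
        rw [← Nat.add_assoc, Nat.add_mod, htu, Nat.mod_eq_of_lt (a := 1) (by omega),
          Nat.mod_eq_of_lt (by omega)]
      have k1 := hw t (by omega)
      have k2 := hw (t + 1) (by omega)
      rw [htu, h1] at k1
      rw [htu', h2, ← k1] at k2
      simp only [Option.some.injEq, Prod.mk.injEq, and_true] at k2
      rcases Nat.mod_two_eq_zero_or_one t with h0 | h0
      · rw [if_neg (by omega), if_pos h0] at k2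
        exact hij k2.symm
      · rw [if_pos (by omega), if_neg (by omega)] at k2
        exact hij k2
    refine ⟨?_, ?_, ?_⟩
    · by_contra hc2
      exact hsucc 0 (by omega) _ (gA 0 (by omega)) (gA 1 (by omega))
    · by_contra hd2
      exact hsucc (c + 0) (by omega) _ (gB 0 (by omega)) (gB 1 (by omega))
    · obtain ⟨t, ht, htu⟩ := hpos 0 (by omega)
      obtain ⟨t', ht', htu'⟩ := hpos (c + 0) (by omega)
      have k1 := hw t (by omega)
      have k2 := hw t' (by omega)
      rw [htu, gA _ (by omega)] at k1
      rw [htu', gB _ (by omega)] at k2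
      simp only [Option.some.injEq, Prod.mk.injEq] at k1 k2
      rw [← k1.2, ← k2.2]

theorem tor_prod {a b : ℕ} {k l : ℤ} (hk : ¬ (7 : ℤ) ∣ k) (hl : ¬ (7 : ℤ) ∣ l) {n : ℕ} (hn : n ≠ 0)
    {g : GT T.Adj} (h : (gen T.Adj a ^ k * (g * gen T.Adj b ^ l * g⁻¹)) ^ n = 1) :
    (a = b ∧ ∃ p : ℤ, g = gen T.Adj a ^ p) ∨
    (a ≠ b ∧ (∃ p q : ℤ, g = gen T.Adj a ^ p * gen T.Adj b ^ q) ∧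
      (((7 : ℤ) ∣ k - 1 ∧ (7 : ℤ) ∣ l - 1) ∨ ((7 : ℤ) ∣ k + 1 ∧ (7 : ℤ) ∣ l + 1))) := by
  classical
  obtain ⟨e, c, hc1, hc, hcA, hcs⟩ := exp_word T a hk
  obtain ⟨f, d, hd1, hd, hdB, hds⟩ := exp_word T b hl
  have hex : ∃ m, ∃ x : FreeGroup ℕ, x.norm = m ∧
      ∃ p q : ℤ, pj T x = gen T.Adj a ^ p * g * gen T.Adj b ^ q := by
    obtain ⟨x, rfl⟩ := pj_surj T g
    exact ⟨_, x, rfl, 0, 0, by simp⟩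
  obtain ⟨G, hG1, p, q, hG2⟩ := Nat.find_spec hex
  have hmin : MinDC T a b G := by
    rintro y ⟨p', q', hy⟩
    rw [hG1]
    refine Nat.find_min' hex ⟨y, rfl, p' + p, q + q', ?_⟩
    rw [hy, hG2, zpow_add, zpow_add]
    group
  have hg : g = gen T.Adj a ^ (-p) * pj T G * gen T.Adj b ^ (-q) := by
    rw [hG2]; group
  have htor : (gen T.Adj a ^ k * (pj T G * gen T.Adj b ^ l * (pj T G)⁻¹)) ^ n = 1 := by
    have := conj_tor (c := gen T.Adj a ^ p) h
    have e : gen T.Adj a ^ k * (pj T G * gen T.Adj b ^ l * (pj T G)⁻¹) =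
      gen T.Adj a ^ p * (gen T.Adj a ^ k * (g * gen T.Adj b ^ l * g⁻¹)) * (gen T.Adj a ^ p)⁻¹ := by
      rw [hG2]; group
    rw [e]; exact this
  by_cases h1 : G = 1
  · rw [h1] at hg htor
    simp only [_root_.map_one, mul_one, one_mul, inv_one] at hg htor
    by_cases hab : a = b
    · left
      subst hab
      exact ⟨rfl, -p + -q, by rw [hg, zpow_add]⟩
    · right
      rw [← hcA, ← hdB, ← _root_.map_mul, mul_mk] at htor
      obtain ⟨rfl, rfl, rfl⟩ := tor_one T hab hc1 hc hd1 hd e f hn htor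
      refine ⟨hab, ⟨-p, -q, hg⟩, ?_⟩
      have a1 := hcs rfl
      have a2 := hds rfl
      cases e
      · right; simpa using And.intro a1 a2
      · left; simpa using And.intro a1 a2
  · exfalso
    have hgne : G.toWord ≠ [] := fun h0 => h1 (toWord_eq_nil_iff.1 h0)
    have hcyc := cyc_word T hmin h1 hc1 hd1 e f
    have hmk : pj T (mk (List.replicate c (a, e) ++ G.toWord ++ List.replicate d (b, f) ++
        invRev G.toWord)) ^ n = 1 := by
      rw [← mul_mk, ← mul_mk, ← mul_mk, ← inv_mk, mk_toWord]
      simp only [_root_.map_mul, _root_.map_inv]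
      rw [hcA, hdB, ← htor]
      congr 1
      group
    obtain ⟨σ, i, j, s, hs, hwin⟩ := torsion_win T hcyc (by simp [hgne]) hn hmk
    by_cases hs2 : s < c + G.toWord.length
    · exact no_seg T hmin h1 hc hd e f σ i j (half_win hgne hwin (by simpa using hs2))
    · have hrot := hwin.rotate ((List.replicate c (a, e)).length + G.toWord.length)
        (s - (c + G.toWord.length)) (by
          congr 1
          simp only [List.length_replicate]
          omega)
      rw [rot_word] at hrot
      have hrot2 : Win (altS σ i j (pr T i j - 2)) (List.replicate d (b, f) ++ invRev G.toWord ++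
        List.replicate c (a, e) ++ invRev (invRev G.toWord)) (s - (c + G.toWord.length)) := by
        rw [invRev_invRev]; exact hrot
      have := half_win (by simpa [invRev] using hgne) hrot2 (by
        simp only [List.length_append, List.length_replicate, invRev_length] at hs ⊢
        omega)
      have := invRev_seg this
      rw [invRev_append, invRev_append, invRev_rep, invRev_rep, invRev_invRev, ← List.append_assoc] at this
      obtain ⟨i', j', hij, hinv⟩ := invRev_altS σ (pr T i j - 2) i j
      rw [hinv] at this
      have hp : pr T i j = pr T i' j' := by
        rcases hij with ⟨rfl, rfl⟩ | ⟨rfl, rfl⟩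
        · rfl
        · exact pr_symm T _ _
      rw [hp] at this
      exact no_seg T hmin h1 hc hd _ _ _ i' j' this

end Wm


namespace Wm

open FreeGroup

variable (T : SimpleGraph ℕ)

theorem cop {H : Type*} [Group H] {x : H} {m n : ℕ} (h1 : x ^ m = 1) (h2 : x ^ n = 1)
    (h : Nat.gcd m n = 1) : x = 1 := by
  have := pow_gcd_eq_one.2 ⟨h1, h2⟩
  rwa [h, pow_one] at this

theorem tor7 {a c : ℕ} (hac : a ≠ c) {P Y : ℤ} (hP : ¬ (7 : ℤ) ∣ P) (hY : ¬ (7 : ℤ) ∣ Y) :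
    (gen T.Adj a ^ P * gen T.Adj c ^ Y) ^ 7 ≠ 1 := by
  intro h
  rcases tor_prod T hP hY (n := 7) (by norm_num) (g := 1) (by simpa using h) with
    ⟨h1, -⟩ | ⟨-, -, ⟨h1, h2⟩ | ⟨h1, h2⟩⟩
  · exact hac h1
  · rw [gen_zpow_mod T h1, gen_zpow_mod T h2, zpow_one, zpow_one] at h
    obtain ⟨m, -, hm, hm2⟩ := gen_pow_pair T hac
    apply gen_mul_ne_one T hac
    rcases hm with rfl | rfl
    · exact cop h hm2 (by norm_num)
    · exact cop h hm2 (by norm_num)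
  · rw [gen_zpow_mod T (k := P) (l := -1) (by simpa using h1),
      gen_zpow_mod T (k := Y) (l := -1) (by simpa using h2),
      zpow_neg_one, zpow_neg_one, ← mul_inv_rev, inv_pow, inv_eq_one] at h
    obtain ⟨m, -, hm, hm2⟩ := gen_pow_pair T hac.symm
    apply gen_mul_ne_one T hac.symm
    rcases hm with rfl | rfl
    · exact cop h hm2 (by norm_num)
    · exact cop h hm2 (by norm_num)

theorem pw {a b : ℕ} (hab : a ≠ b) {P Q : ℤ} (h : gen T.Adj a ^ P = gen T.Adj b ^ Q) :
    (7 : ℤ) ∣ P := by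
  by_contra hP
  by_cases hQ : (7 : ℤ) ∣ Q
  · rw [gen_zpow_mod T (l := 0) (i := b) (by simpa using hQ), zpow_zero] at h
    exact hP (gen_zpow_eq_one T h)
  · apply tor7 T hab hP (Y := -Q) (by rwa [dvd_neg])
    rw [h, ← zpow_add]; simp

theorem gen_zpow_pow7 (a : ℕ) (k : ℤ) : (gen T.Adj a ^ k) ^ 7 = 1 := by
  rw [← zpow_natCast, ← zpow_mul, mul_comm, zpow_mul, zpow_natCast, gen7, one_zpow]

theorem indep {a b c : ℕ} (hab : a ≠ b) (hac : a ≠ c) {P Y Q : ℤ}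
    (h : gen T.Adj a ^ P * gen T.Adj c ^ Y = gen T.Adj b ^ Q) : (7 : ℤ) ∣ P := by
  by_contra hP
  by_cases hY : (7 : ℤ) ∣ Y
  · rw [gen_zpow_mod T (l := 0) (i := c) (by simpa using hY), zpow_zero, mul_one] at h
    exact hP (pw T hab h)
  · apply tor7 T hac hP hY
    rw [h, gen_zpow_pow7]

theorem adj_iff {i j : ℕ} (hij : i ≠ j) : T.Adj i j ↔ (gen T.Adj i * gen T.Adj j) ^ 11 = 1 := by
  constructor
  · exact gen11 T
  · intro h
    by_contra hn
    exact gen_mul_ne_one T hij (cop h (gen13 T hij hn) (by norm_num))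

theorem gen_image (θ : GT T.Adj →* GT T.Adj) (hθ : Function.Injective θ) (i : ℕ) :
    ∃ (r : ℕ) (k : ℤ) (t : GT T.Adj), ¬ (7 : ℤ) ∣ k ∧ θ (gen T.Adj i) = t * gen T.Adj r ^ k * t⁻¹ := by
  have h7 : θ (gen T.Adj i) ^ 7 = 1 := by rw [← _root_.map_pow, gen7, _root_.map_one]
  have hne : θ (gen T.Adj i) ≠ 1 := by
    intro h
    exact gen_ne_one T i (hθ (by rw [h, _root_.map_one]))
  rcases torsion_conj T (by norm_num) h7 hne with ⟨r, k, hk⟩ | ⟨r, s, k, hrs, hk⟩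
  · obtain ⟨t, ht⟩ := isConj_iff.1 hk.symm
    refine ⟨r, k, t, ?_, ht.symm⟩
    intro hk7
    rw [gen_zpow_mod T (l := 0) (by simpa using hk7), zpow_zero] at ht
    apply hne
    rw [← ht]; simp
  · exfalso
    obtain ⟨t, ht⟩ := isConj_iff.1 hk.symm
    obtain ⟨m, -, hm, hm2⟩ := gen_pow_pair T hrs
    have : θ (gen T.Adj i) ^ m = 1 := by
      rw [← ht]
      apply conj_tor
      rw [← zpow_natCast, ← zpow_mul, mul_comm, zpow_mul, zpow_natCast, hm2, one_zpow]
    apply hne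
    rcases hm with rfl | rfl
    · exact cop h7 this (by norm_num)
    · exact cop h7 this (by norm_num)

theorem inj_form (θ : GT T.Adj →* GT T.Adj) (hθ : Function.Injective θ) :
    ∃ (r : ℕ → ℕ) (t : GT T.Adj) (ε : ℤ), Function.Injective r ∧ (ε = 1 ∨ ε = -1) ∧
      ∀ i, θ (gen T.Adj i) = t * gen T.Adj (r i) ^ ε * t⁻¹ := by
  choose r k t hk ht using gen_image T θ hθ
  have pair : ∀ i j, i ≠ j → r i ≠ r j ∧
      (∃ p q : ℤ, (t i)⁻¹ * t j = gen T.Adj (r i) ^ p * gen T.Adj (r j) ^ q) ∧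
      (((7 : ℤ) ∣ k i - 1 ∧ (7 : ℤ) ∣ k j - 1) ∨ ((7 : ℤ) ∣ k i + 1 ∧ (7 : ℤ) ∣ k j + 1)) := by
    intro i j hij
    obtain ⟨m, -, hm, hm2⟩ := gen_pow_pair T hij
    have h1 : (gen T.Adj (r i) ^ k i * ((t i)⁻¹ * t j * gen T.Adj (r j) ^ k j * ((t i)⁻¹ * t j)⁻¹)) ^ m = 1 := by
      have h2 : θ ((gen T.Adj i * gen T.Adj j) ^ m) = 1 := by rw [hm2, _root_.map_one]
      rw [_root_.map_pow, _root_.map_mul, ht i, ht j] at h2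
      have := conj_tor (c := (t i)⁻¹) h2
      rw [← this]
      congr 1
      group
    rcases tor_prod T (hk i) (hk j) (by omega) h1 with ⟨h2, p, h3⟩ | h2
    · exfalso
      have hj : t j = t i * gen T.Adj (r i) ^ p := by rw [← h3]; group
      have hj2 : θ (gen T.Adj j) = t i * gen T.Adj (r i) ^ k j * (t i)⁻¹ := by
        rw [ht j, hj, ← h2]
        group
      apply gen_comm_ne T hij
      apply hθ
      rw [_root_.map_mul, _root_.map_mul, hj2, ht i]
      have : gen T.Adj (r i) ^ k i * gen T.Adj (r i) ^ k j =
        gen T.Adj (r i) ^ k j * gen T.Adj (r i) ^ k i := by rw [← zpow_add, ← zpow_add, add_comm]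
      calc _ = t i * (gen T.Adj (r i) ^ k i * gen T.Adj (r i) ^ k j) * (t i)⁻¹ := by group
        _ = _ := by rw [this]; group
    · exact h2
  obtain ⟨ε, hε, hkε⟩ : ∃ ε : ℤ, (ε = 1 ∨ ε = -1) ∧ ∀ i, (7 : ℤ) ∣ k i - ε := by
    obtain ⟨-, -, h⟩ := pair 0 1 (by norm_num)
    rcases h with h | h
    · refine ⟨1, Or.inl rfl, fun i => ?_⟩
      by_cases hi : i = 0
      · rw [hi]; exact h.1
      · obtain ⟨-, -, h'⟩ := pair 0 i (Ne.symm hi)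
        omega
    · refine ⟨-1, Or.inr rfl, fun i => ?_⟩
      by_cases hi : i = 0
      · rw [hi]; simpa using h.1
      · obtain ⟨-, -, h'⟩ := pair 0 i (Ne.symm hi)
        omega
  have hT : ∀ i, θ (gen T.Adj i) = t i * gen T.Adj (r i) ^ ε * (t i)⁻¹ := by
    intro i
    rw [ht i, gen_zpow_mod T (hkε i)]
  have fin : ∀ (s : GT T.Adj) (i : ℕ) (y : ℤ), t i = s * gen T.Adj (r i) ^ y →
      θ (gen T.Adj i) = s * gen T.Adj (r i) ^ ε * s⁻¹ := by
    intro s i y h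
    rw [hT i, h]
    group
  obtain ⟨h01, ⟨p, q, hpq⟩, -⟩ := pair 0 1 (by norm_num)
  refine ⟨r, t 0 * gen T.Adj (r 0) ^ p, ε, ?_, hε, ?_⟩
  · intro i j hij
    by_contra h
    exact (pair i j h).1 hij
  have e1 : t 1 = t 0 * gen T.Adj (r 0) ^ p * gen T.Adj (r 1) ^ q := by
    rw [mul_assoc, ← hpq]; group
  intro j
  by_cases hj0 : j = 0
  · subst hj0
    exact fin _ _ (-p) (by group)
  by_cases hj1 : j = 1
  · subst hj1
    exact fin _ _ q e1
  obtain ⟨h0j, ⟨x, y, hxy⟩, -⟩ := pair 0 j (Ne.symm hj0)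
  obtain ⟨h1j, ⟨z, w, hzw⟩, -⟩ := pair 1 j (Ne.symm hj1)
  have d0 : t j = t 0 * gen T.Adj (r 0) ^ p * (gen T.Adj (r 0) ^ (x - p) * gen T.Adj (r j) ^ y) := by
    have : t j = t 0 * (gen T.Adj (r 0) ^ x * gen T.Adj (r j) ^ y) := by rw [← hxy]; group
    rw [this]; group
  have d1 : t j = t 0 * gen T.Adj (r 0) ^ p * (gen T.Adj (r 1) ^ (q + z) * gen T.Adj (r j) ^ w) := by
    have : t j = t 1 * (gen T.Adj (r 1) ^ z * gen T.Adj (r j) ^ w) := by rw [← hzw]; group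
    rw [this, e1]; group
  have hd := mul_left_cancel (d0.symm.trans d1)
  have h7 : (7 : ℤ) ∣ x - p := by
    apply indep T h01 h0j (Y := y - w) (Q := q + z)
    rw [zpow_sub (gen T.Adj (r j)), ← mul_assoc, hd]; group
  apply fin _ _ y
  rw [d0, gen_zpow_mod T (k := x - p) (l := 0) (by simpa using h7), zpow_zero, one_mul]

theorem adj_pres (θ : GT T.Adj →* GT T.Adj) (hθ : Function.Injective θ) {r : ℕ → ℕ} {t : GT T.Adj}
    {ε : ℤ} (hr : Function.Injective r) (hε : ε = 1 ∨ ε = -1)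
    (h : ∀ i, θ (gen T.Adj i) = t * gen T.Adj (r i) ^ ε * t⁻¹) (m n : ℕ) :
    T.Adj m n ↔ T.Adj (r m) (r n) := by
  by_cases hmn : m = n
  · subst hmn; simp
  have hmn' : r m ≠ r n := fun h => hmn (hr h)
  have e1 : (gen T.Adj m * gen T.Adj n) ^ 11 = 1 ↔
      (gen T.Adj (r m) ^ ε * gen T.Adj (r n) ^ ε) ^ 11 = 1 := by
    rw [← hθ.eq_iff, _root_.map_pow, _root_.map_mul, h m, h n, _root_.map_one]
    have : t * gen T.Adj (r m) ^ ε * t⁻¹ * (t * gen T.Adj (r n) ^ ε * t⁻¹) =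
      t * (gen T.Adj (r m) ^ ε * gen T.Adj (r n) ^ ε) * t⁻¹ := by group
    rw [this, conj_pow, conj_eq_one_iff]
  rw [adj_iff T hmn, e1]
  rcases hε with rfl | rfl
  · rw [zpow_one, zpow_one, adj_iff T hmn']
  · rw [zpow_neg_one, zpow_neg_one, ← mul_inv_rev, inv_pow, inv_eq_one, T.adj_comm,
      adj_iff T hmn'.symm]

theorem conj_gen {i b : ℕ} {l : ℤ} (hl : l = 1 ∨ l = -1) {g : GT T.Adj}
    (h : gen T.Adj i = g * gen T.Adj b ^ l * g⁻¹) : i = b := by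
  have h1 : (gen T.Adj i ^ (-1 : ℤ) * (g * gen T.Adj b ^ l * g⁻¹)) ^ 1 = 1 := by
    rw [← h]; simp
  rcases tor_prod T (by norm_num) (by rcases hl with rfl | rfl <;> norm_num) one_ne_zero h1 with
    ⟨h2, -⟩ | ⟨h2, ⟨p, q, hg⟩, -⟩
  · exact h2
  · exfalso
    have : gen T.Adj i ^ (1 : ℤ) = gen T.Adj b ^ l := by
      have e : gen T.Adj b ^ l = g⁻¹ * gen T.Adj i * g := by rw [h]; group
      have e2 : gen T.Adj b ^ q * gen T.Adj b ^ l * (gen T.Adj b ^ q)⁻¹ = gen T.Adj i ^ (1 : ℤ) := by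
        rw [e, hg]; group
      rw [← e2]; group
    have := pw T h2 this
    norm_num at this

theorem forward (θ : GT T.Adj →* GT T.Adj) (hθ : Function.Bijective θ) :
    ∃ ρ : ℕ ≃ ℕ, (∀ m n, T.Adj m n ↔ T.Adj (ρ m) (ρ n)) ∧
          ∃ t : GT T.Adj, ∃ ε : ℤ, (ε = 1 ∨ ε = -1) ∧
            ∀ i, θ (gen T.Adj i) = t * gen T.Adj (ρ i) ^ ε * t⁻¹ := by
  obtain ⟨r, t, ε, hr, hε, h⟩ := inj_form T θ hθ.1
  let E := MulEquiv.ofBijective θ hθ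
  obtain ⟨s, u, δ, hs, hδ, h'⟩ := inj_form T E.symm.toMonoidHom E.symm.injective
  have hsurj : Function.Surjective r := by
    intro i
    refine ⟨s i, ?_⟩
    have e0 : θ (E.symm (gen T.Adj i)) = gen T.Adj i := E.apply_symm_apply _
    have e1 : E.symm (gen T.Adj i) = u * gen T.Adj (s i) ^ δ * u⁻¹ := h' i
    rw [e1, _root_.map_mul, _root_.map_mul, _root_.map_inv, _root_.map_zpow, h, conj_zpow, ← zpow_mul] at e0
    symm
    apply conj_gen T (l := ε * δ) (g := θ u * t)
    · rcases hε with rfl | rfl <;> rcases hδ with rfl | rfl <;> simp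
    · rw [← e0]; group
  refine ⟨Equiv.ofBijective r ⟨hr, hsurj⟩, ?_, t, ε, hε, h⟩
  exact adj_pres T θ hθ.1 hr hε h

theorem lift_ok (ρ : ℕ ≃ ℕ) (hρ : ∀ m n, T.Adj m n ↔ T.Adj (ρ m) (ρ n)) {ε : ℤ}
    (hε : ε = 1 ∨ ε = -1) : ∃ φ : GT T.Adj →* GT T.Adj,
      ∀ i, φ (gen T.Adj i) = gen T.Adj (ρ i) ^ ε := by
  have hr : ∀ x ∈ grRels T.Adj, FreeGroup.lift (fun i => gen T.Adj (ρ i) ^ ε) x = 1 := by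
    have pw2 : ∀ i j m, (gen T.Adj (ρ i) * gen T.Adj (ρ j)) ^ m = 1 →
        (gen T.Adj (ρ j) * gen T.Adj (ρ i)) ^ m = 1 →
        (gen T.Adj (ρ i) ^ ε * gen T.Adj (ρ j) ^ ε) ^ m = 1 := by
      intro i j m h1 h2
      rcases hε with rfl | rfl
      · simpa using h1
      · rw [zpow_neg_one, zpow_neg_one, ← mul_inv_rev, inv_pow, h2, inv_one]
    rintro x (⟨i, rfl⟩ | ⟨i, j, hij, rfl⟩ | ⟨i, j, hij, hn, rfl⟩)
    · rw [_root_.map_pow, lift_apply_of]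
      exact gen_zpow_pow7 T _ _
    · rw [_root_.map_pow, _root_.map_mul, lift_apply_of, lift_apply_of]
      exact pw2 _ _ _ (gen11 T ((hρ _ _).1 hij)) (gen11 T ((hρ _ _).1 hij.symm))
    · rw [_root_.map_pow, _root_.map_mul, lift_apply_of, lift_apply_of]
      have hne : ρ i ≠ ρ j := fun h => hij (ρ.injective h)
      exact pw2 _ _ _ (gen13 T hne (fun h => hn ((hρ _ _).2 h)))
        (gen13 T hne.symm (fun h => hn ((hρ _ _).2 h.symm)))
  exact ⟨PresentedGroup.toGroup hr, fun i => PresentedGroup.toGroup.of hr⟩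

theorem backward (θ : GT T.Adj →* GT T.Adj) (ρ : ℕ ≃ ℕ)
    (hρ : ∀ m n, T.Adj m n ↔ T.Adj (ρ m) (ρ n)) (t : GT T.Adj) {ε : ℤ} (hε : ε = 1 ∨ ε = -1)
    (h : ∀ i, θ (gen T.Adj i) = t * gen T.Adj (ρ i) ^ ε * t⁻¹) : Function.Bijective θ := by
  obtain ⟨φ, hφ⟩ := lift_ok T ρ hρ hε
  obtain ⟨ψ, hψ⟩ := lift_ok T ρ.symm (fun m n => by rw [hρ (ρ.symm m), ρ.apply_symm_apply, ρ.apply_symm_apply]) hε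
  have hεε : ε * ε = 1 := by rcases hε with rfl | rfl <;> simp
  have e1 : φ.comp ψ = MonoidHom.id _ := by
    apply PresentedGroup.ext
    intro i
    change φ (ψ (gen T.Adj i)) = gen T.Adj i
    rw [hψ, _root_.map_zpow, hφ, ← zpow_mul, hεε, ρ.apply_symm_apply, zpow_one]
  have e2 : ψ.comp φ = MonoidHom.id _ := by
    apply PresentedGroup.ext
    intro i
    change ψ (φ (gen T.Adj i)) = gen T.Adj i
    rw [hφ, _root_.map_zpow, hψ, ← zpow_mul, hεε, ρ.symm_apply_apply, zpow_one]
  have e3 : θ = (MulAut.conj t).toMonoidHom.comp φ := by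
    apply PresentedGroup.ext
    intro i
    change θ (gen T.Adj i) = t * φ (gen T.Adj i) * t⁻¹
    rw [hφ, h]
  have hb : Function.Bijective φ :=
    Function.bijective_iff_has_inverse.2 ⟨ψ, fun x => DFunLike.congr_fun e2 x,
      fun x => DFunLike.congr_fun e1 x⟩
  rw [e3]
  exact (MulAut.conj t).bijective.comp hb

end Wm

theorem aut_GT_iff (T : SimpleGraph ℕ) (θ : GT T.Adj → GT T.Adj) :
    (Function.Bijective θ ∧ ∀ w w', θ (w * w') = θ w * θ w') ↔
      ((∀ w w', θ (w * w') = θ w * θ w') ∧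
        ∃ ρ : ℕ ≃ ℕ, (∀ m n, T.Adj m n ↔ T.Adj (ρ m) (ρ n)) ∧
          ∃ t : GT T.Adj, ∃ ε : ℤ, (ε = 1 ∨ ε = -1) ∧
            ∀ i, θ (gen T.Adj i) = t * gen T.Adj (ρ i) ^ ε * t⁻¹) := by
  constructor
  · rintro ⟨hb, hm⟩
    exact ⟨hm, Wm.forward T (MonoidHom.mk' θ hm) hb⟩
  · rintro ⟨hm, ρ, hρ, t, ε, hε, h⟩
    exact ⟨Wm.backward T (MonoidHom.mk' θ hm) ρ hρ t hε h, hm⟩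
end

section
/- Let T be a simple graph on vertex set ℕ. If ρ, ρ' ∈ Aut(T), t, t' ∈ G_T, and ε, ε' ∈ {−1, 1} satisfy t v_{ρ(i)}^ε t^{−1} = t' v_{ρ'(i)}^{ε'} t'^{−1} in G_T for every i ∈ ℕ, then ρ = ρ', t = t', and ε = ε'. -/
namespace GTproof

/-- First block of the pair dynamics. -/
def matA (a b : ZMod 307) : Matrix (Fin 6) (Fin 6) (ZMod 307) :=
  !![283, -1, a, b, 1, 0; 1, 0, 0, 0, 0, 0; 0, 0, 1, 0, 0, 0; 0, 0, 0, 1, 0, 0;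
    0, 0, 0, 0, 1, 0; 0, 0, 0, 0, 0, 1]

/-- Second block of the pair dynamics. -/
def matB (c d : ZMod 307) : Matrix (Fin 6) (Fin 6) (ZMod 307) :=
  !![1, 0, 0, 0, 0, 0; 0, 1, 0, 0, 0, 0; c, d, 283, -1, 0, 1; 0, 0, 1, 0, 0, 0;
    0, 0, 0, 0, 1, 0; 0, 0, 0, 0, 0, 1]

/-- Dynamics of a single vertex. -/
def matC : Matrix (Fin 3) (Fin 3) (ZMod 307) := !![283, -1, 1; 1, 0, 0; 0, 0, 1]

lemma matC_pow : matC ^ 7 = 1 := by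
  have h : matC ^ 3 = matC * matC * matC := by rw [pow_succ, pow_two]
  rw [show (7 : ℕ) = 3 + 3 + 1 from rfl, pow_add, pow_add, h, pow_one]
  decide +kernel

lemma matPow_54 : (matA 54 54 * matB 54 54) ^ 11 = 1 := by
  have h1 : matA 54 54 * matB 54 54 =
      !![129, 152, 293, 253, 1, 54; 1, 0, 0, 0, 0, 0; 54, 54, 283, 306, 0, 1; 0, 0, 1, 0, 0, 0; 0, 0, 0, 0, 1, 0; 0, 0, 0, 0, 0, 1] := by decide +kernel
  rw [h1]
  have h2 : (!![129, 152, 293, 253, 1, 54; 1, 0, 0, 0, 0, 0; 54, 54, 283, 306, 0, 1; 0, 0, 1, 0, 0, 0; 0, 0, 0, 0, 1, 0; 0, 0, 0, 0, 0, 1] : Matrix (Fin 6) (Fin 6) (ZMod 307)) ^ 3 =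
      !![5, 24, 51, 38, 203, 214; 73, 125, 11, 109, 130, 252; 269, 60, 215, 234, 252, 203; 198, 158, 126, 178, 54, 130; 0, 0, 0, 0, 1, 0; 0, 0, 0, 0, 0, 1] := by
    rw [pow_succ, pow_two]; decide +kernel
  generalize hX : (!![129, 152, 293, 253, 1, 54; 1, 0, 0, 0, 0, 0; 54, 54, 283, 306, 0, 1; 0, 0, 1, 0, 0, 0; 0, 0, 0, 0, 1, 0; 0, 0, 0, 0, 0, 1] : Matrix (Fin 6) (Fin 6) (ZMod 307)) = X at h2 ⊢
  have h3 : X ^ 6 =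
      !![302, 211, 1, 14, 208, 214; 261, 261, 14, 0, 254, 228; 293, 279, 137, 46, 228, 208; 0, 14, 261, 261, 228, 254; 0, 0, 0, 0, 1, 0; 0, 0, 0, 0, 0, 1] := by
    rw [show X ^ 6 = X ^ 3 * X ^ 3 from pow_add X 3 3, h2]; decide +kernel
  rw [show (11 : ℕ) = 6 + 3 + 1 + 1 from rfl, pow_add, pow_add, pow_add, h3, h2, pow_one, ← hX]
  decide +kernel

lemma matPow_22 : (matA 22 248 * matB 248 22) ^ 13 = 1 := by
  have h1 : matA 22 248 * matB 248 22 =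
      !![213, 176, 27, 285, 1, 22; 1, 0, 0, 0, 0, 0; 248, 22, 283, 306, 0, 1; 0, 0, 1, 0, 0, 0; 0, 0, 0, 0, 1, 0; 0, 0, 0, 0, 0, 1] := by decide +kernel
  rw [h1]
  have h2 : (!![213, 176, 27, 285, 1, 22; 1, 0, 0, 0, 0, 0; 248, 22, 283, 306, 0, 1; 0, 0, 1, 0, 0, 0; 0, 0, 0, 0, 1, 0; 0, 0, 0, 0, 0, 1] : Matrix (Fin 6) (Fin 6) (ZMod 307)) ^ 3 =
      !![292, 107, 283, 244, 265, 193; 51, 14, 169, 199, 214, 130; 207, 278, 36, 256, 171, 265; 230, 140, 210, 94, 248, 214; 0, 0, 0, 0, 1, 0; 0, 0, 0, 0, 0, 1] := by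
    rw [pow_succ, pow_two]; decide +kernel
  generalize hX : (!![213, 176, 27, 285, 1, 22; 1, 0, 0, 0, 0, 0; 248, 22, 283, 306, 0, 1; 0, 0, 1, 0, 0, 0; 0, 0, 0, 0, 1, 0; 0, 0, 0, 0, 0, 1] : Matrix (Fin 6) (Fin 6) (ZMod 307)) = X at h2 ⊢
  have h3 : X ^ 6 =
      !![39, 58, 51, 41, 74, 269; 268, 61, 203, 143, 113, 3; 41, 51, 58, 39, 269, 74; 12, 177, 4, 137, 257, 113; 0, 0, 0, 0, 1, 0; 0, 0, 0, 0, 0, 1] := by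
    rw [show X ^ 6 = X ^ 3 * X ^ 3 from pow_add X 3 3, h2]; decide +kernel
  rw [show (13 : ℕ) = 6 + 6 + 1 from rfl, pow_add, pow_add, h3, pow_one, ← hX]; decide +kernel

lemma matPow_248 : (matA 248 22 * matB 22 248) ^ 13 = 1 := by
  have h1 : matA 248 22 * matB 22 248 =
      !![213, 103, 210, 59, 1, 248; 1, 0, 0, 0, 0, 0; 22, 248, 283, 306, 0, 1; 0, 0, 1, 0, 0, 0; 0, 0, 0, 0, 1, 0; 0, 0, 0, 0, 0, 1] := by decide +kernel
  rw [h1]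
  have h2 : (!![213, 103, 210, 59, 1, 248; 1, 0, 0, 0, 0, 0; 22, 248, 283, 306, 0, 1; 0, 0, 1, 0, 0, 0; 0, 0, 0, 0, 1, 0; 0, 0, 0, 0, 0, 1] : Matrix (Fin 6) (Fin 6) (ZMod 307)) ^ 3 =
      !![292, 16, 222, 100, 265, 71; 51, 32, 146, 77, 214, 171; 63, 260, 18, 256, 130, 265; 108, 305, 283, 94, 22, 214; 0, 0, 0, 0, 1, 0; 0, 0, 0, 0, 0, 1] := by
    rw [pow_succ, pow_two]; decide +kernel
  generalize hX : (!![213, 103, 210, 59, 1, 248; 1, 0, 0, 0, 0, 0; 22, 248, 283, 306, 0, 1; 0, 0, 1, 0, 0, 0; 0, 0, 0, 0, 1, 0; 0, 0, 0, 0, 0, 1] : Matrix (Fin 6) (Fin 6) (ZMod 307)) = X at h2 ⊢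
  have h3 : X ^ 6 =
      !![39, 76, 295, 266, 74, 3; 268, 43, 196, 295, 113, 269; 266, 295, 76, 39, 3, 74; 164, 148, 120, 137, 146, 113; 0, 0, 0, 0, 1, 0; 0, 0, 0, 0, 0, 1] := by
    rw [show X ^ 6 = X ^ 3 * X ^ 3 from pow_add X 3 3, h2]; decide +kernel
  rw [show (13 : ℕ) = 6 + 6 + 1 from rfl, pow_add, pow_add, h3, pow_one, ← hX]; decide +kernel

open Classical in
/-- Coupling coefficient of `p`. -/
noncomputable def ca (Adj : ℕ → ℕ → Prop) (l i : ℕ) : ZMod 307 :=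
  if Adj l i then 54 else if l < i then 22 else 248

open Classical in
/-- Coupling coefficient of `q`. -/
noncomputable def cb (Adj : ℕ → ℕ → Prop) (l i : ℕ) : ZMod 307 :=
  if Adj l i then 54 else if l < i then 248 else 22

/-- The states. -/
abbrev St := ℕ → ZMod 307 × ZMod 307 × ZMod 307

/-- Action of the `i`-th generator on states. -/
noncomputable def act (Adj : ℕ → ℕ → Prop) (i : ℕ) (w : St) : St := fun l =>
  if l = i then (283 * (w i).1 - (w i).2.1 + (w i).2.2, (w i).1, (w i).2.2)
  else ((w l).1, (w l).2.1, (w l).2.2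
    + ca Adj l i * ((283 * (w i).1 - (w i).2.1 + (w i).2.2) - (w i).1)
    + cb Adj l i * ((w i).1 - (w i).2.1))

lemma act_self (Adj : ℕ → ℕ → Prop) (i : ℕ) (w : St) : act Adj i w i =
    (283 * (w i).1 - (w i).2.1 + (w i).2.2, (w i).1, (w i).2.2) := by simp [act]

lemma act_ne (Adj : ℕ → ℕ → Prop) {i l : ℕ} (h : l ≠ i) (w : St) : act Adj i w l =
    ((w l).1, (w l).2.1, (w l).2.2
    + ca Adj l i * ((283 * (w i).1 - (w i).2.1 + (w i).2.2) - (w i).1)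
    + cb Adj l i * ((w i).1 - (w i).2.1)) := by simp [act, h]

lemma iter_inv {X Y : Type*} (f : X → X) (J : X → Y) (h : ∀ x, J (f x) = J x) (n : ℕ) (x : X) :
    J (f^[n] x) = J x := by
  induction n generalizing x with
  | zero => rfl
  | succ n ih => rw [Function.iterate_succ_apply, ih, h]

lemma iter_mat {X : Type*} {d : ℕ} (f : X → X) (u : X → Fin d → ZMod 307)
    (M : Matrix (Fin d) (Fin d) (ZMod 307))
    (h : ∀ x, u (f x) = M.mulVec (u x)) (n : ℕ) (x : X) :
    u (f^[n] x) = (M ^ n).mulVec (u x) := by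
  induction n generalizing x with
  | zero => simp
  | succ n ih => rw [Function.iterate_succ_apply, ih, h, Matrix.mulVec_mulVec, pow_succ]

lemma act_seven (Adj : ℕ → ℕ → Prop) (i : ℕ) (w : St) : (act Adj i)^[7] w = w := by
  have hu := iter_mat (act Adj i) (fun w => ![(w i).1, (w i).2.1, (w i).2.2]) matC (by
    intro x
    ext r
    fin_cases r <;> simp [act_self, matC, Matrix.mulVec, dotProduct, Fin.sum_univ_three]
    ring) 7 w
  rw [matC_pow, Matrix.one_mulVec] at hu
  have h1 := congrFun hu 0
  have h2 := congrFun hu 1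
  have h3 := congrFun hu 2
  simp only [Matrix.cons_val_zero, Matrix.cons_val_one, Matrix.cons_val] at h1 h2 h3
  funext l
  by_cases hl : l = i
  · subst hl
    exact Prod.ext h1 (Prod.ext h2 h3)
  · have e1 := iter_inv (act Adj i) (fun w => (w l).1) (by intro x; simp [act_ne Adj hl]) 7 w
    have e2 := iter_inv (act Adj i) (fun w => (w l).2.1) (by intro x; simp [act_ne Adj hl]) 7 w
    have e3 := iter_inv (act Adj i)
      (fun w => (w l).2.2 - ca Adj l i * (w i).1 - cb Adj l i * (w i).2.1)
      (by intro x; simp only [act_ne Adj hl, act_self]; ring) 7 w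
    simp only [h1, h2] at e3
    exact Prod.ext e1 (Prod.ext e2 (by linear_combination e3))

lemma act_pair (Adj : ℕ → ℕ → Prop) {i j : ℕ} (hij : i ≠ j) (m : ℕ)
    (hm : (matA (ca Adj i j) (cb Adj i j) * matB (ca Adj j i) (cb Adj j i)) ^ m = 1) (w : St) :
    (act Adj i ∘ act Adj j)^[m] w = w := by
  have hji := hij.symm
  have hu := iter_mat (act Adj i ∘ act Adj j) (fun w => ![(w i).1, (w i).2.1, (w j).1, (w j).2.1,
      (w i).2.2 - ca Adj i j * (w j).1 - cb Adj i j * (w j).2.1,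
      (w j).2.2 - ca Adj j i * (w i).1 - cb Adj j i * (w i).2.1])
      (matA (ca Adj i j) (cb Adj i j) * matB (ca Adj j i) (cb Adj j i)) (by
    intro x
    rw [← Matrix.mulVec_mulVec]
    have hB : (matB (ca Adj j i) (cb Adj j i)).mulVec ![(x i).1, (x i).2.1, (x j).1, (x j).2.1,
      (x i).2.2 - ca Adj i j * (x j).1 - cb Adj i j * (x j).2.1,
      (x j).2.2 - ca Adj j i * (x i).1 - cb Adj j i * (x i).2.1] =
      ![(x i).1, (x i).2.1, 283 * (x j).1 - (x j).2.1 + (x j).2.2, (x j).1,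
      (x i).2.2 - ca Adj i j * (x j).1 - cb Adj i j * (x j).2.1,
      (x j).2.2 - ca Adj j i * (x i).1 - cb Adj j i * (x i).2.1] := by
      ext r
      fin_cases r <;> simp [matB, Matrix.mulVec, dotProduct, Fin.sum_univ_six]
      ring
    rw [hB]
    ext r
    fin_cases r <;> simp [matA, Matrix.mulVec, dotProduct, Fin.sum_univ_six, act_self,
      act_ne Adj hij, act_ne Adj hji] <;> ring) m w
  rw [hm, Matrix.one_mulVec] at hu
  have h1 := congrFun hu 0
  have h2 := congrFun hu 1
  have h3 := congrFun hu 2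
  have h4 := congrFun hu 3
  have h5 := congrFun hu 4
  have h6 := congrFun hu 5
  simp only [Matrix.cons_val_zero, Matrix.cons_val_one, Matrix.cons_val] at h1 h2 h3 h4 h5 h6
  simp only [h1, h2, h3, h4] at h5 h6
  funext l
  by_cases hi : l = i
  · subst hi
    exact Prod.ext h1 (Prod.ext h2 (by linear_combination h5))
  by_cases hj : l = j
  · subst hj
    exact Prod.ext h3 (Prod.ext h4 (by linear_combination h6))
  have e1 := iter_inv (act Adj i ∘ act Adj j) (fun w => (w l).1)
    (by intro x; simp [act_ne Adj hi, act_ne Adj hj]) m w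
  have e2 := iter_inv (act Adj i ∘ act Adj j) (fun w => (w l).2.1)
    (by intro x; simp [act_ne Adj hi, act_ne Adj hj]) m w
  have e3 := iter_inv (act Adj i ∘ act Adj j)
      (fun w => (w l).2.2 - ca Adj l i * (w i).1 - cb Adj l i * (w i).2.1
        - ca Adj l j * (w j).1 - cb Adj l j * (w j).2.1)
      (by
        intro x
        simp only [Function.comp, act_ne Adj hi, act_ne Adj hj, act_ne Adj hij, act_ne Adj hji,
          act_self]
        ring) m w
  simp only [h1, h2, h3, h4] at e3
  exact Prod.ext e1 (Prod.ext e2 (by linear_combination e3))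

lemma act_adj (T : SimpleGraph ℕ) {i j : ℕ} (h : T.Adj i j) (w : St) :
    (act T.Adj i ∘ act T.Adj j)^[11] w = w := by
  apply act_pair T.Adj h.ne
  simp only [ca, cb, h, h.symm, if_true]
  exact matPow_54

lemma act_nadj (T : SimpleGraph ℕ) {i j : ℕ} (hij : i ≠ j) (h : ¬ T.Adj i j) (w : St) :
    (act T.Adj i ∘ act T.Adj j)^[13] w = w := by
  apply act_pair T.Adj hij
  have h' : ¬ T.Adj j i := fun h' => h h'.symm
  rcases lt_or_gt_of_ne hij with hl | hl
  · simp only [ca, cb, h, h', if_false, hl, not_lt_of_gt hl, if_true]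
    exact matPow_22
  · simp only [ca, cb, h, h', if_false, hl, not_lt_of_gt hl, if_true]
    exact matPow_248

/-- Indicator of `1`. -/
def dl (p : ZMod 307) : ℤ := if p = 1 then 1 else 0

/-- The exponent used in the twisted action. -/
def el (k : ℕ) (w : St) : ℤ := dl (w k).1 - dl (w k).2.1

lemma el_act (Adj : ℕ → ℕ → Prop) {k j : ℕ} (h : k ≠ j) (w : St) :
    el k (act Adj j w) = el k w := by simp [el, act_ne Adj h]

lemma el_cases (k : ℕ) (w : St) : el k w = 0 ∨ el k w = 1 ∨ el k w = -1 := by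
  unfold el dl; split_ifs <;> simp

/-- The twisted action of the generators. -/
noncomputable def tw (Adj : ℕ → ℕ → Prop) (k i : ℕ) (x : GT Adj × St) : GT Adj × St :=
  (if i = k then x.1 else gen Adj i ^ el k x.2 * x.1, act Adj i x.2)

lemma tw_self (Adj : ℕ → ℕ → Prop) (k : ℕ) (x : GT Adj × St) :
    tw Adj k k x = (x.1, act Adj k x.2) := by simp [tw]

lemma tw_ne (Adj : ℕ → ℕ → Prop) {k i : ℕ} (h : i ≠ k) (x : GT Adj × St) :
    tw Adj k i x = (gen Adj i ^ el k x.2 * x.1, act Adj i x.2) := by simp [tw, h]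

lemma iter_snd {X Y : Type*} (f : X × Y → X × Y) (g : Y → Y) (h : ∀ x, (f x).2 = g x.2)
    (n : ℕ) (x : X × Y) : (f^[n] x).2 = g^[n] x.2 := by
  induction n generalizing x with
  | zero => rfl
  | succ n ih => rw [Function.iterate_succ_apply, ih, h, Function.iterate_succ_apply]

lemma gen_rel (Adj : ℕ → ℕ → Prop) (r : FreeGroup ℕ) (h : r ∈ grRels Adj) :
    PresentedGroup.mk (grRels Adj) r = 1 := PresentedGroup.one_of_mem h

lemma gen_seven (Adj : ℕ → ℕ → Prop) (i : ℕ) : gen Adj i ^ 7 = 1 := by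
  have := gen_rel Adj (FreeGroup.of i ^ 7) (Or.inl ⟨i, rfl⟩)
  rwa [map_pow] at this

lemma gen_adj (Adj : ℕ → ℕ → Prop) {i j : ℕ} (h : Adj i j) :
    (gen Adj i * gen Adj j) ^ 11 = 1 := by
  have := gen_rel Adj _ (Or.inr (Or.inl ⟨i, j, h, rfl⟩))
  rwa [map_pow, map_mul] at this

lemma gen_nadj (Adj : ℕ → ℕ → Prop) {i j : ℕ} (hij : i ≠ j) (h : ¬ Adj i j) :
    (gen Adj i * gen Adj j) ^ 13 = 1 := by
  have := gen_rel Adj _ (Or.inr (Or.inr ⟨i, j, hij, h, rfl⟩))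
  rwa [map_pow, map_mul] at this

lemma zpow_pair {G : Type*} [Group G] {a b : G} {m : ℕ} (h : (a * b) ^ m = 1) {e : ℤ}
    (he : e = 0 ∨ e = 1 ∨ e = -1) : (a ^ e * b ^ e) ^ m = 1 := by
  rcases he with rfl | rfl | rfl
  · simp
  · simpa using h
  · have h2 : (b * a) ^ m = 1 := by
      have : b * a = b * (a * b) * b⁻¹ := by group
      rw [this, conj_pow, h]; simp
    rw [zpow_neg_one, zpow_neg_one, ← mul_inv_rev, inv_pow, h2, inv_one]

lemma iter_fst {X G : Type*} [Group G] (f : G × X → G × X) (e : X → G)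
    (h1 : ∀ x, (f x).1 = e x.2 * x.1) (h2 : ∀ x, e (f x).2 = e x.2) (n : ℕ) (x : G × X) :
    (f^[n] x).1 = e x.2 ^ n * x.1 := by
  induction n generalizing x with
  | zero => simp
  | succ n ih => rw [Function.iterate_succ_apply, ih, h1, h2, pow_succ, mul_assoc]

lemma tw_seven (Adj : ℕ → ℕ → Prop) (k i : ℕ) (x : GT Adj × St) :
    (tw Adj k i)^[7] x = x := by
  have hs : ((tw Adj k i)^[7] x).2 = x.2 := by
    rw [iter_snd _ (act Adj i) (fun _ => rfl), act_seven]
  refine Prod.ext ?_ hs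
  by_cases h : i = k
  · subst h
    exact iter_inv (tw Adj i i) Prod.fst (fun x => by rw [tw_self]) 7 x
  · rw [iter_fst (tw Adj k i) (fun w => gen Adj i ^ el k w) (fun x => by rw [tw_ne Adj h])
      (fun x => by rw [tw_ne Adj h]; simp only [el_act Adj (Ne.symm h)])]
    rw [← zpow_natCast, zpow_comm, zpow_natCast, gen_seven]; simp

lemma tw_pair (Adj : ℕ → ℕ → Prop) (k : ℕ) {i j : ℕ} (hij : i ≠ j) (m : ℕ)
    (hact : ∀ w, (act Adj i ∘ act Adj j)^[m] w = w) (hgen : (gen Adj i * gen Adj j) ^ m = 1)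
    (x : GT Adj × St) : (tw Adj k i ∘ tw Adj k j)^[m] x = x := by
  have hs : ((tw Adj k i ∘ tw Adj k j)^[m] x).2 = x.2 := by
    rw [iter_snd _ (act Adj i ∘ act Adj j) (fun _ => rfl), hact]
  refine Prod.ext ?_ hs
  by_cases hi : i = k
  · subst hi
    have := iter_inv (tw Adj i i ∘ tw Adj i j)
      (fun x => gen Adj j ^ (-dl (x.2 i).2.1) * x.1) (fun x => by
        simp only [Function.comp, tw_self, tw_ne Adj hij.symm, act_self, act_ne Adj hij, el]
        rw [← mul_assoc, ← zpow_add]; congr 2; ring) m x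
    simp only [hs] at this
    exact mul_left_cancel this
  by_cases hj : j = k
  · subst hj
    have := iter_inv (tw Adj j i ∘ tw Adj j j)
      (fun x => gen Adj i ^ (-dl (x.2 j).1) * x.1) (fun x => by
        simp only [Function.comp, tw_self, tw_ne Adj hij, act_self, act_ne Adj hij.symm, el]
        rw [← mul_assoc, ← zpow_add]; congr 2; ring) m x
    simp only [hs] at this
    exact mul_left_cancel this
  rw [iter_fst (tw Adj k i ∘ tw Adj k j) (fun w => gen Adj i ^ el k w * gen Adj j ^ el k w)
    (fun x => by
      simp only [Function.comp, tw_ne Adj hi, tw_ne Adj hj, el_act Adj (Ne.symm hj), mul_assoc])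
    (fun x => by
      simp only [Function.comp, tw_ne Adj hi, tw_ne Adj hj, el_act Adj (Ne.symm hj),
        el_act Adj (Ne.symm hi)])]
  rw [zpow_pair hgen (el_cases k _), one_mul]

/-- The twisted action as permutations. -/
noncomputable def twP (Adj : ℕ → ℕ → Prop) (k i : ℕ) : Equiv.Perm (GT Adj × St) where
  toFun := tw Adj k i
  invFun := (tw Adj k i)^[6]
  left_inv x := by
    rw [← Function.iterate_succ_apply]; exact tw_seven Adj k i x
  right_inv x := by
    rw [← Function.iterate_succ_apply' (tw Adj k i)]; exact tw_seven Adj k i x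

lemma perm_pow_apply {X : Type*} (f : Equiv.Perm X) (n : ℕ) (x : X) : (f ^ n) x = f^[n] x := by
  rw [← Equiv.Perm.iterate_eq_pow]

/-- The homomorphism given by the twisted action. -/
noncomputable def twH (T : SimpleGraph ℕ) (k : ℕ) : GT T.Adj →* Equiv.Perm (GT T.Adj × St) :=
  PresentedGroup.toGroup (f := twP T.Adj k) (by
    rintro r (⟨i, rfl⟩ | ⟨i, j, h, rfl⟩ | ⟨i, j, hij, h, rfl⟩)
    · rw [map_pow, FreeGroup.lift_apply_of]
      ext1 x
      rw [perm_pow_apply]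
      exact tw_seven T.Adj k i x
    · rw [map_pow, map_mul, FreeGroup.lift_apply_of, FreeGroup.lift_apply_of]
      ext1 x
      rw [perm_pow_apply]
      exact tw_pair T.Adj k h.ne 11 (act_adj T h) (gen_adj _ h) x
    · rw [map_pow, map_mul, FreeGroup.lift_apply_of, FreeGroup.lift_apply_of]
      ext1 x
      rw [perm_pow_apply]
      exact tw_pair T.Adj k hij 13 (act_nadj T hij h) (gen_nadj _ hij h) x)

lemma twH_gen (T : SimpleGraph ℕ) (k i : ℕ) (x : GT T.Adj × St) :
    twH T k (gen T.Adj i) x = tw T.Adj k i x := by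
  rw [twH, gen, PresentedGroup.toGroup.of]; rfl

lemma twH_gen_inv (T : SimpleGraph ℕ) (k i : ℕ) (x y : GT T.Adj × St)
    (h : tw T.Adj k i y = x) :
    twH T k (gen T.Adj i)⁻¹ x = y := by
  rw [map_inv, Equiv.Perm.inv_eq_iff_eq, twH_gen, h]

/-- The subgroup generated by the generators other than `v_k`. -/
def Ak (T : SimpleGraph ℕ) (k : ℕ) : Subgroup (GT T.Adj) :=
  Subgroup.closure {g | ∃ j, j ≠ k ∧ g = gen T.Adj j}

/-- The action of elements of `A_k`. -/
lemma Ak_act (T : SimpleGraph ℕ) (k : ℕ) (s : GT T.Adj) (hs : s ∈ Ak T k) :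
    ∀ x : GT T.Adj × St, ((twH T k s x).2 k).1 = (x.2 k).1 ∧
      ((twH T k s x).2 k).2.1 = (x.2 k).2.1 ∧
      (el k x.2 = 0 → (twH T k s x).1 = x.1) ∧ (el k x.2 = 1 → (twH T k s x).1 = s * x.1) := by
  induction hs using Subgroup.closure_induction with
  | mem g hg =>
    obtain ⟨j, hj, rfl⟩ := hg
    intro x
    rw [twH_gen, tw_ne _ hj]
    refine ⟨?_, ?_, ?_, ?_⟩
    · simp [act_ne _ hj.symm]
    · simp [act_ne _ hj.symm]
    · intro h; simp [h]
    · intro h; simp [h]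
  | one => intro x; simp
  | mul a b _ _ ha hb =>
    intro x
    obtain ⟨b1, b2, b3, b4⟩ := hb x
    obtain ⟨a1, a2, a3, a4⟩ := ha (twH T k b x)
    have he : el k (twH T k b x).2 = el k x.2 := by simp only [el, b1, b2]
    rw [he] at a3 a4
    rw [map_mul, Equiv.Perm.mul_apply]
    refine ⟨a1.trans b1, a2.trans b2, fun h => (a3 h).trans (b3 h), fun h => ?_⟩
    rw [a4 h, b4 h, mul_assoc]
  | inv a _ ha =>
    intro x
    obtain ⟨a1, a2, a3, a4⟩ := ha (twH T k a⁻¹ x)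
    have hx : twH T k a (twH T k a⁻¹ x) = x := by
      rw [← Equiv.Perm.mul_apply, ← map_mul]; simp
    rw [hx] at a1 a2 a3 a4
    have he : el k (twH T k a⁻¹ x).2 = el k x.2 := by simp only [el, a1, a2]
    rw [he] at a3 a4
    refine ⟨a1.symm, a2.symm, fun h => (a3 h).symm, fun h => ?_⟩
    rw [a4 h]; group

/-- Test state. -/
def w0 : St := fun _ => (1, 0, 25)

lemma gen_notMem (T : SimpleGraph ℕ) (k : ℕ) : gen T.Adj k ∉ Ak T k := by
  intro h
  have h1 := (Ak_act T k _ h (1, fun _ => (0, 0, 1))).1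
  rw [twH_gen, tw_self] at h1
  simp only [act_self] at h1
  revert h1
  decide

lemma gen_zpow_mem (T : SimpleGraph ℕ) {k : ℕ} {ε : ℤ} (hε : ε = 1 ∨ ε = -1)
    {H : Subgroup (GT T.Adj)} (h : gen T.Adj k ^ ε ∈ H) : gen T.Adj k ∈ H := by
  rcases hε with rfl | rfl <;> simpa using h

lemma el_pm (T : SimpleGraph ℕ) (k : ℕ) {ε : ℤ} (hε : ε = 1 ∨ ε = -1) :
    ∃ w : St, el k w = 0 ∧ ∀ g, twH T k (gen T.Adj k ^ ε) (g, w0) = (g, w) := by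
  rcases hε with rfl | rfl
  · refine ⟨act T.Adj k w0, ?_, fun g => ?_⟩
    · simp only [el, act_self, w0]; decide
    · rw [zpow_one, twH_gen, tw_self]
  · have h7 : act T.Adj k ((act T.Adj k)^[6] w0) = w0 := by
      rw [← Function.iterate_succ_apply' (act T.Adj k)]; exact act_seven T.Adj k w0
    refine ⟨(act T.Adj k)^[6] w0, ?_, fun g => ?_⟩
    · generalize (act T.Adj k)^[6] w0 = w at h7
      have hk := congrFun h7 k
      rw [act_self] at hk
      simp only [w0, Prod.mk.injEq] at hk
      obtain ⟨h1, h2, h3⟩ := hk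
      have h4 : (w k).2.1 = 24 := by
        rw [h2, h3] at h1; linear_combination - h1
      simp only [el, h2, h4]; decide
    · rw [zpow_neg_one]
      apply twH_gen_inv
      rw [tw_self, h7]

lemma comm_eq_one (T : SimpleGraph ℕ) (k : ℕ) (s : GT T.Adj) (hs : s ∈ Ak T k) {ε ε' : ℤ}
    (hε : ε = 1 ∨ ε = -1) (hε' : ε' = 1 ∨ ε' = -1)
    (h : s * gen T.Adj k ^ ε = gen T.Adj k ^ ε' * s) : s = 1 := by
  obtain ⟨w, hw, hg⟩ := el_pm T k hε
  have h1 : (twH T k (s * gen T.Adj k ^ ε) (1, w0)).1 = 1 := by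
    rw [map_mul, Equiv.Perm.mul_apply, hg]
    exact (Ak_act T k s hs (1, w)).2.2.1 hw
  have h0 : el k w0 = 1 := by simp only [el, w0]; decide
  have h2 : (twH T k (gen T.Adj k ^ ε' * s) (1, w0)).1 = s := by
    rw [map_mul, Equiv.Perm.mul_apply]
    have hs1 : (twH T k s (1, w0)).1 = s := by
      simpa using (Ak_act T k s hs (1, w0)).2.2.2 h0
    have key : ∀ x, (twH T k (gen T.Adj k) x).1 = x.1 := fun x => by rw [twH_gen, tw_self]
    rcases hε' with rfl | rfl
    · rw [zpow_one, key, hs1]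
    · rw [zpow_neg_one]
      have := key (twH T k (gen T.Adj k)⁻¹ (twH T k s (1, w0)))
      rw [← Equiv.Perm.mul_apply, ← map_mul, mul_inv_cancel, map_one, Equiv.Perm.one_apply] at this
      rw [← this, hs1]
  rw [← h2, ← h, h1]

lemma exists_finite (T : SimpleGraph ℕ) (s : GT T.Adj) :
    ∃ n : ℕ, ∀ k, n ≤ k → s ∈ Ak T k := by
  have hs : s ∈ Subgroup.closure (Set.range (PresentedGroup.of (rels := grRels T.Adj))) := by
    rw [PresentedGroup.closure_range_of]; trivial
  induction hs using Subgroup.closure_induction with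
  | mem g hg =>
    obtain ⟨j, rfl⟩ := hg
    exact ⟨j + 1, fun k hk => Subgroup.subset_closure ⟨j, by omega, rfl⟩⟩
  | one => exact ⟨0, fun k _ => one_mem _⟩
  | mul a b _ _ ha hb =>
    obtain ⟨n, hn⟩ := ha
    obtain ⟨m, hm⟩ := hb
    exact ⟨max n m, fun k hk => mul_mem (hn k (le_trans (le_max_left _ _) hk))
      (hm k (le_trans (le_max_right _ _) hk))⟩
  | inv a _ ha =>
    obtain ⟨n, hn⟩ := ha
    exact ⟨n, fun k hk => inv_mem (hn k hk)⟩

lemma gen_mem_Ak (T : SimpleGraph ℕ) {j k : ℕ} (h : j ≠ k) : gen T.Adj j ∈ Ak T k :=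
  Subgroup.subset_closure ⟨j, h, rfl⟩

end GTproof

/-- **Uniqueness of the data inducing an automorphism of `G_T`.**
If `t v_{ρ(i)}^ε t⁻¹ = t' v_{ρ'(i)}^{ε'} t'⁻¹` for every `i`, where `ρ, ρ'` are graph
automorphisms of `T`, `t, t' ∈ G_T` and `ε, ε' ∈ {-1, 1}`, then `ρ = ρ'`, `t = t'` and
`ε = ε'`. -/
theorem aut_GT_data_unique (T : SimpleGraph ℕ) (ρ ρ' : ℕ ≃ ℕ)
    (hρ : ∀ m n, T.Adj m n ↔ T.Adj (ρ m) (ρ n))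
    (hρ' : ∀ m n, T.Adj m n ↔ T.Adj (ρ' m) (ρ' n))
    (t t' : GT T.Adj) (ε ε' : ℤ) (hε : ε = 1 ∨ ε = -1) (hε' : ε' = 1 ∨ ε' = -1)
    (h : ∀ i, t * gen T.Adj (ρ i) ^ ε * t⁻¹ = t' * gen T.Adj (ρ' i) ^ ε' * t'⁻¹) :
    ρ = ρ' ∧ t = t' ∧ ε = ε' := by
  obtain ⟨k, hk⟩ := GTproof.exists_finite T (t'⁻¹ * t)
  have hs := hk k le_rfl
  set s := t'⁻¹ * t with hsdef
  obtain ⟨i, hi⟩ := ρ.surjective k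
  have hsk : s * gen T.Adj k ^ ε * s⁻¹ = gen T.Adj (ρ' i) ^ ε' := by
    have h1 := h i
    rw [hi] at h1
    calc s * gen T.Adj k ^ ε * s⁻¹ = t'⁻¹ * (t * gen T.Adj k ^ ε * t⁻¹) * t' := by
          rw [hsdef]; group
      _ = _ := by rw [h1]; group
  have hρi : ρ' i = k := by
    by_contra hne
    have hm : gen T.Adj (ρ' i) ^ ε' ∈ GTproof.Ak T k :=
      Subgroup.zpow_mem _ (GTproof.gen_mem_Ak T hne) _
    have h2 : gen T.Adj k ^ ε ∈ GTproof.Ak T k := by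
      have : gen T.Adj k ^ ε = s⁻¹ * gen T.Adj (ρ' i) ^ ε' * s := by rw [← hsk]; group
      rw [this]
      exact mul_mem (mul_mem (inv_mem hs) hm) hs
    exact GTproof.gen_notMem T k (GTproof.gen_zpow_mem T hε h2)
  rw [hρi] at hsk
  have hs1 : s = 1 := by
    apply GTproof.comm_eq_one T k s hs hε hε'
    rw [← hsk]; group
  have htt : t = t' := (inv_mul_eq_one.mp hs1).symm
  have hee : ε = ε' := by
    by_contra hne
    rw [hs1, one_mul, inv_one, mul_one] at hsk
    have h2 : gen T.Adj k ^ 2 = 1 := by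
      have : gen T.Adj k = (gen T.Adj k)⁻¹ := by
        rcases hε with rfl | rfl <;> rcases hε' with rfl | rfl
        · exact absurd rfl hne
        · simpa using hsk
        · simpa using hsk.symm
        · exact absurd rfl hne
      rw [pow_two]
      nth_rewrite 1 [this]
      simp
    have h7 := GTproof.gen_seven T.Adj k
    have h1 : gen T.Adj k = 1 := by
      have : gen T.Adj k ^ 7 = (gen T.Adj k ^ 2) ^ 3 * gen T.Adj k := by
        rw [← pow_mul, ← pow_succ]
      rw [h7, h2, one_pow, one_mul] at this
      exact this.symm
    exact GTproof.gen_notMem T k (h1 ▸ one_mem _)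
  refine ⟨?_, htt, hee⟩
  ext l
  by_contra hne
  have h1 := h l
  rw [htt, hee] at h1
  have h2 : gen T.Adj (ρ l) ^ ε' = gen T.Adj (ρ' l) ^ ε' :=
    mul_left_cancel (mul_right_cancel h1)
  have h3 : gen T.Adj (ρ l) ^ ε' ∈ GTproof.Ak T (ρ l) := by
    rw [h2]
    exact Subgroup.zpow_mem _ (GTproof.gen_mem_Ak T (Ne.symm hne)) _
  exact GTproof.gen_notMem T _ (GTproof.gen_zpow_mem T hε' h3)
end

section
/- Let T be a simple graph on vertex set ℕ. For all n, m ∈ ℕ, u ∈ G_T, and k ∈ ℤ: if v_n = u v_m^k u^{−1} holds in G_T, then n = m. (In other words, if the generator v_n is conjugate in G_T to a power of the generator v_m, then n = m.) -/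
open Polynomial in
theorem pow_eq_one_of_roots {K A : Type*} [Field K] [Ring A] [Algebra K A] (T : A) (p : ℕ)
    (hp : 0 < p) (l : Multiset K) (hl : l.Nodup) (hr : ∀ x ∈ l, x ^ p = 1)
    (h : aeval T ((l.map (fun x => X - C x)).prod) = 0) : T ^ p = 1 := by
  have hne : (X ^ p - 1 : K[X]) ≠ 0 := (monic_X_pow_sub_C (1 : K) hp.ne').ne_zero
  have hd : (l.map (fun x => X - C x)).prod ∣ (X ^ p - 1 : K[X]) := by
    rw [Multiset.prod_X_sub_C_dvd_iff_le_roots hne, Multiset.le_iff_subset hl]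
    intro x hx
    rw [mem_roots hne]
    simp [hr x hx]
  obtain ⟨q, hq⟩ := hd
  have h2 : aeval T (X ^ p - 1 : K[X]) = 0 := by rw [hq, map_mul, h, zero_mul]
  simpa [sub_eq_zero] using h2

theorem pow_eq_one_two {K V : Type*} [Field K] [AddCommGroup V] [Module K V]
    (T : Module.End K V) (p : ℕ) (hp : 2 < p) (a : K) (ha : IsPrimitiveRoot a p)
    (h : ∀ g, T (T (T g - g)) - (a + a ^ (p - 1)) • T (T g - g) + (T g - g) = 0) :
    T ^ p = 1 := by
  have hab : a * a ^ (p - 1) = 1 := by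
    rw [← pow_succ', Nat.sub_add_cancel (by omega), ha.pow_eq_one]
  have inj : ∀ x y, x < p → y < p → a ^ x = a ^ y → x = y := fun x y hx hy e =>
    ha.pow_inj hx hy e
  refine pow_eq_one_of_roots T p (by omega) {a ^ (p - 1), a ^ 1, a ^ 0} ?_ ?_ ?_
  · simp only [Multiset.insert_eq_cons, Multiset.nodup_cons, Multiset.mem_cons,
      Multiset.mem_singleton, Multiset.nodup_singleton, not_or, and_true]
    refine ⟨⟨fun e => ?_, fun e => ?_⟩, fun e => ?_⟩ <;>
    · have := inj _ _ (by omega) (by omega) e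
      omega
  · intro x hx
    simp only [Multiset.insert_eq_cons, Multiset.mem_cons, Multiset.mem_singleton] at hx
    rcases hx with rfl | rfl | rfl <;> rw [pow_right_comm, ha.pow_eq_one, one_pow]
  · ext g
    have := h g
    simp only [Multiset.insert_eq_cons, Multiset.map_cons, Multiset.map_singleton,
      Multiset.prod_cons, Multiset.prod_singleton, map_mul, map_sub, Polynomial.aeval_X,
      Polynomial.aeval_C, pow_zero, pow_one, map_one, Module.End.mul_apply,
      LinearMap.sub_apply, Module.algebraMap_end_apply, Module.End.one_apply,
      LinearMap.zero_apply, map_smul] at this ⊢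
    rw [← this]
    linear_combination (norm := module) hab • (T g - g)

theorem pow_eq_one_three {K V : Type*} [Field K] [AddCommGroup V] [Module K V]
    (T : Module.End K V) (p : ℕ) (hp : 5 < p) (a : K) (ha : IsPrimitiveRoot a p)
    (h : ∀ g, T (T (T (T g - g))) - (a + a ^ 2 + a ^ (p - 3)) • T (T (T g - g))
      + (a * a ^ 2 + (a + a ^ 2) * a ^ (p - 3)) • T (T g - g) - (T g - g) = 0) :
    T ^ p = 1 := by
  have hab : a * a ^ 2 * a ^ (p - 3) = 1 := by
    rw [← pow_succ', ← pow_add, show 2 + 1 + (p - 3) = p by omega, ha.pow_eq_one]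
  have inj : ∀ x y, x < p → y < p → a ^ x = a ^ y → x = y := fun x y hx hy e =>
    ha.pow_inj hx hy e
  refine pow_eq_one_of_roots T p (by omega) {a ^ (p - 3), a ^ 2, a ^ 1, a ^ 0} ?_ ?_ ?_
  · simp only [Multiset.insert_eq_cons, Multiset.nodup_cons, Multiset.mem_cons,
      Multiset.mem_singleton, Multiset.nodup_singleton, not_or, and_true]
    refine ⟨⟨fun e => ?_, fun e => ?_, fun e => ?_⟩, ⟨fun e => ?_, fun e => ?_⟩,
      fun e => ?_⟩ <;>
    · have := inj _ _ (by omega) (by omega) e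
      omega
  · intro x hx
    simp only [Multiset.insert_eq_cons, Multiset.mem_cons, Multiset.mem_singleton] at hx
    rcases hx with rfl | rfl | rfl | rfl <;> rw [pow_right_comm, ha.pow_eq_one, one_pow]
  · ext g
    have := h g
    simp only [Multiset.insert_eq_cons, Multiset.map_cons, Multiset.map_singleton,
      Multiset.prod_cons, Multiset.prod_singleton, map_mul, map_sub, Polynomial.aeval_X,
      Polynomial.aeval_C, pow_zero, pow_one, map_one, Module.End.mul_apply,
      LinearMap.sub_apply, Module.algebraMap_end_apply, Module.End.one_apply,
      LinearMap.zero_apply, map_smul] at this ⊢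
    rw [← this]
    linear_combination (norm := module) (-hab) • (T g - g)

/-- Transvection `g ↦ g + g(i) (c, s)`. -/
def trv {K : Type*} [Field K] (i : ℕ) (c : ℕ → K) (s : K) : Module.End K ((ℕ → K) × K) where
  toFun g := (fun j => g.1 j + g.1 i * c j, g.2 + g.1 i * s)
  map_add' x y := by
    ext <;> simp <;> ring
  map_smul' x y := by
    ext <;> simp <;> ring

/-- The special unipotent element for the vertex `n`. -/
def spc {K : Type*} [Field K] (n : ℕ) : Module.End K ((ℕ → K) × K) where
  toFun g := (fun j => g.1 j + g.2 * (if j = n then 0 else 1), g.2 + g.1 n)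
  map_add' x y := by
    ext <;> simp <;> (try split_ifs) <;> ring
  map_smul' x y := by
    ext <;> simp <;> (try split_ifs) <;> ring

theorem trv_sq {K : Type*} [Field K] (i : ℕ) (c : ℕ → K) (s : K) (h : c i = 0) :
    (trv i c s - 1) ^ 2 = 0 := by
  apply LinearMap.ext
  intro g
  ext <;> simp [trv, pow_two, h]

theorem spc_cube {K : Type*} [Field K] (n : ℕ) : (spc n - 1 : Module.End K ((ℕ → K) × K)) ^ 3 = 0 := by
  apply LinearMap.ext
  intro g
  ext <;> simp [spc, pow_succ]

theorem spc_sq_ne {K : Type*} [Field K] (n m : ℕ) (h : n ≠ m) :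
    (spc n - 1 : Module.End K ((ℕ → K) × K)) ^ 2 ≠ 0 := by
  intro e
  have := congrFun (congrArg Prod.fst (LinearMap.congr_fun e (fun _ => 1, 0))) m
  simp [spc, pow_two, h.symm] at this

theorem unip_pow {K : Type*} [Field K] [CharP K 7] {A : Type*} [Ring A] [Algebra K A] (T : A)
    (h : (T - 1) ^ 3 = 0) : T ^ 7 = 1 := by
  have h7 : (7 : A) = 0 := by
    have := congrArg (algebraMap K A) (CharP.cast_eq_zero K 7)
    rw [map_natCast, map_zero] at this
    exact_mod_cast this
  obtain ⟨x, rfl⟩ : ∃ x, T = x + 1 := ⟨T - 1, by simp⟩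
  simp only [add_sub_cancel_right] at h
  have e : (x + 1) ^ 7 = x ^ 3 * (x ^ 4) + 7 * (x ^ 6 + 3 * x ^ 5 + 5 * x ^ 4 + 5 * x ^ 3
    + 3 * x ^ 2 + x) + 1 := by noncomm_ring
  rw [e, h, h7]; simp

theorem trv_mul {K : Type*} [Field K] (i j : ℕ) (c d : ℕ → K) (s t : K)
    (hc : c i = 0) (hd : d j = 0) (p : ℕ) (hp : 2 < p) (a : K) (ha : IsPrimitiveRoot a p)
    (h : c j * d i = a + a ^ (p - 1) - 2) : (trv i c s * trv j d t) ^ p = 1 := by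
  apply pow_eq_one_two _ p hp a ha
  intro g
  rw [show a + a ^ (p - 1) = c j * d i + 2 by rw [h]; ring]
  ext <;> simp [trv, hc, hd] <;> ring

theorem spc_mul {K : Type*} [Field K] (n i : ℕ) (hi : i ≠ n) (c : ℕ → K) (s : K)
    (hc : c i = 0) (p : ℕ) (hp : 5 < p) (a : K) (ha : IsPrimitiveRoot a p)
    (h1 : s = (a + a ^ 2 + a ^ (p - 3)) - 3)
    (h2 : c n = (a + a ^ 2 + a ^ (p - 3)) - (a * a ^ 2 + (a + a ^ 2) * a ^ (p - 3))) :
    (spc n * trv i c s) ^ p = 1 := by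
  apply pow_eq_one_three _ p hp a ha
  intro g
  rw [show a * a ^ 2 + (a + a ^ 2) * a ^ (p - 3) = s + 3 - c n by rw [h1, h2]; ring,
    show a + a ^ 2 + a ^ (p - 3) = s + 3 by rw [h1]; ring]
  ext <;> simp [trv, spc, hc, hi] <;> (try split_ifs) <;> ring

theorem pow_swap {M : Type*} [Monoid M] (x y : M) (hx : x ^ 7 = 1) (p : ℕ)
    (h : (x * y) ^ p = 1) : (y * x) ^ p = 1 := by
  have e : x * (y * x) ^ p = x := by rw [← mul_pow_mul, h, one_mul]
  have h6 : x ^ 6 * x = 1 := by rw [← pow_succ, hx]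
  calc (y * x) ^ p = x ^ 6 * x * (y * x) ^ p := by rw [h6, one_mul]
    _ = 1 := by rw [mul_assoc, e, h6]

theorem exists_rep (T : SimpleGraph ℕ) (n : ℕ) :
    ∃ (A : Type) (_ : Ring A) (V : ℕ → A), (∀ i, V i ^ 7 = 1) ∧
      (∀ i, i ≠ n → (V i - 1) ^ 2 = 0) ∧ (V n - 1) ^ 2 ≠ 0 ∧
      (∀ i j, T.Adj i j → (V i * V j) ^ 11 = 1) ∧
      (∀ i j, i ≠ j → ¬ T.Adj i j → (V i * V j) ^ 13 = 1) := by
  classical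
  have : Fact (Nat.Prime 7) := ⟨by norm_num⟩
  let K := AlgebraicClosure (ZMod 7)
  have : CharP K 7 := inferInstance
  have hz : ∀ m : ℕ, ¬ 7 ∣ m → ((m : ℕ) : K) ≠ 0 := fun m hm e =>
    hm ((CharP.cast_eq_zero_iff K 7 m).1 e)
  have : NeZero ((11 : ℕ) : K) := ⟨hz 11 (by norm_num)⟩
  have : NeZero ((13 : ℕ) : K) := ⟨hz 13 (by norm_num)⟩
  obtain ⟨a, ha⟩ := HasEnoughRootsOfUnity.exists_primitiveRoot K 11
  obtain ⟨b, hb⟩ := HasEnoughRootsOfUnity.exists_primitiveRoot K 13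
  -- order and root for each pair
  let P : ℕ → ℕ → ℕ := fun i j => if T.Adj i j then 11 else 13
  let R : ℕ → ℕ → K := fun i j => if T.Adj i j then a else b
  have hR : ∀ i j, IsPrimitiveRoot (R i j) (P i j) := by
    intro i j
    by_cases h : T.Adj i j <;> simp [R, P, h, ha, hb]
  have hP : ∀ i j, 5 < P i j := by
    intro i j
    by_cases h : T.Adj i j <;> simp [P, h]
  have Psymm : ∀ i j, P i j = P j i := fun i j => by simp only [P, T.adj_comm]
  have Rsymm : ∀ i j, R i j = R j i := fun i j => by simp only [R, T.adj_comm]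
  let c : ℕ → ℕ → K := fun i j =>
    if i = j then 0 else
    if j = n then (R n i + R n i ^ 2 + R n i ^ (P n i - 3))
      - (R n i * R n i ^ 2 + (R n i + R n i ^ 2) * R n i ^ (P n i - 3)) else
    if i < j then R i j + R i j ^ (P i j - 1) - 2 else 1
  let s : ℕ → K := fun i => (R n i + R n i ^ 2 + R n i ^ (P n i - 3)) - 3
  let V : ℕ → Module.End K ((ℕ → K) × K) := fun i => if i = n then spc n else trv i (c i) (s i)
  have hcc : ∀ i, c i i = 0 := fun i => by simp [c]
  have hVn : V n = spc n := by simp [V]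
  have hVi : ∀ i, i ≠ n → V i = trv i (c i) (s i) := fun i hi => by simp [V, hi]
  have h7 : ∀ i, V i ^ 7 = 1 := by
    intro i
    apply unip_pow (K := K)
    by_cases hi : i = n
    · rw [hi, hVn]; exact spc_cube n
    · rw [hVi i hi, pow_succ, trv_sq _ _ _ (hcc i), zero_mul]
  have hn : ∀ i, i ≠ n → (V n * V i) ^ (P n i) = 1 := by
    intro i hi
    rw [hVn, hVi i hi]
    exact spc_mul n i hi (c i) (s i) (hcc i) _ (hP n i) _ (hR n i) rfl (by simp [c, hi])
  have hlt : ∀ i j, i < j → i ≠ n → j ≠ n → (V i * V j) ^ (P i j) = 1 := by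
    intro i j hij hi hj
    rw [hVi i hi, hVi j hj]
    have := hP i j
    refine trv_mul i j _ _ _ _ (hcc i) (hcc j) _ (by omega) _ (hR i j) ?_
    have h1 : c i j = R i j + R i j ^ (P i j - 1) - 2 := by simp [c, hij.ne, hj, hij]
    have h2 : c j i = 1 := by simp [c, hij.ne', hi, hij.not_gt]
    rw [h1, h2, mul_one]
  have hall : ∀ i j, i ≠ j → (V i * V j) ^ (P i j) = 1 := by
    intro i j hij
    by_cases hi : i = n
    · subst hi; exact hn j hij.symm
    by_cases hj : j = n
    · subst hj; rw [Psymm]; exact pow_swap _ _ (h7 _) _ (hn i hij)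
    rcases lt_or_gt_of_ne hij with h | h
    · exact hlt i j h hi hj
    · rw [Psymm]; exact pow_swap _ _ (h7 _) _ (hlt j i h hj hi)
  refine ⟨_, inferInstance, V, h7, ?_, ?_, ?_, ?_⟩
  · intro i hi; rw [hVi i hi]; exact trv_sq _ _ _ (hcc i)
  · rw [hVn]; exact spc_sq_ne n (n + 1) (by omega)
  · intro i j h
    have := hall i j h.ne
    simpa [P, h] using this
  · intro i j hij h
    have := hall i j hij
    simpa [P, h] using this

/-- In `G_T`, if a generator `v_n` is conjugate to a power of a generator `v_m`,
then `n = m`. -/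
theorem gen_conj_pow_gen (T : SimpleGraph ℕ) (n m : ℕ) (u : GT T.Adj) (k : ℤ)
    (h : gen T.Adj n = u * gen T.Adj m ^ k * u⁻¹) : n = m := by
  by_contra hnm
  obtain ⟨A, _, V, h7, hsq, hne, h11, h13⟩ := exists_rep T n
  let U : ℕ → Aˣ := fun i => Units.ofPowEqOne (V i) 7 (h7 i) (by norm_num)
  have hU : ∀ i, (U i : A) = V i := fun i => rfl
  have hrel : ∀ r ∈ grRels T.Adj, FreeGroup.lift U r = 1 := by
    rintro r (⟨i, rfl⟩ | ⟨i, j, hij, rfl⟩ | ⟨i, j, hij, hn, rfl⟩)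
    · ext; simp [hU, h7]
    · ext; simp [hU, h11 i j hij]
    · ext; simp [hU, h13 i j hij hn]
  let φ : GT T.Adj →* Aˣ := PresentedGroup.toGroup hrel
  have hφ : ∀ i, φ (gen T.Adj i) = U i := fun i => PresentedGroup.toGroup.of hrel
  have e := congrArg φ h
  simp only [map_mul, map_zpow, map_inv, hφ] at e
  have hsub : ((U m : A) - 1) ^ 2 = 0 := hsq m (Ne.symm hnm)
  have h7m : U m ^ (7 : ℕ) = 1 := by ext; simp [hU, h7]
  obtain ⟨l, hl⟩ : ∃ l : ℕ, U m ^ k = U m ^ l := by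
    refine ⟨(k % 7).toNat, ?_⟩
    rw [← zpow_natCast, Int.toNat_of_nonneg (Int.emod_nonneg _ (by norm_num))]
    conv_lhs => rw [← Int.emod_add_mul_ediv k 7, zpow_add, zpow_mul]
    have : U m ^ (7 : ℤ) = 1 := by exact_mod_cast h7m
    rw [this, one_zpow, mul_one]
  rw [hl] at e
  have hl2 : ((U m : A) ^ l - 1) ^ 2 = 0 := by
    have hc := (Commute.refl (U m : A)).sub_left (Commute.one_left _)
    have : (U m : A) ^ l - 1 = ((U m : A) - 1) * ∑ i ∈ Finset.range l, (U m : A) ^ i :=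
      (mul_geom_sum _ _).symm
    have hcs : Commute ((U m : A) - 1) (∑ i ∈ Finset.range l, (U m : A) ^ i) :=
      Commute.sum_right _ _ _ (fun i _ => hc.pow_right i)
    rw [this, hcs.mul_pow, hsub, zero_mul]
  apply hne
  have e2 : V n = (φ u : A) * (U m : A) ^ l * ((φ u)⁻¹ : Aˣ) := by
    rw [← hU, e]; simp
  have e3 : V n - 1 = (φ u : A) * ((U m : A) ^ l - 1) * ((φ u)⁻¹ : Aˣ) := by
    rw [e2, mul_sub, sub_mul]; simp
  rw [e3, pow_two]
  calc _ = (φ u : A) * ((U m : A) ^ l - 1) * (((φ u)⁻¹ : Aˣ) * (φ u : A)) *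
        ((U m : A) ^ l - 1) * ((φ u)⁻¹ : Aˣ) := by simp only [mul_assoc]
    _ = (φ u : A) * ((U m : A) ^ l - 1) ^ 2 * ((φ u)⁻¹ : Aˣ) := by
        simp [pow_two, mul_assoc]
    _ = 0 := by rw [hl2]; simp
end
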